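/- arXiv:2308.08879 — 13 statements merged into one kernel-verified Lean document; each statement's English description precedes it below -/
import Mathlib

section
/- For any choice of indices j_i ∈ {1, …, n_i} (i = 0, …, r), the determinant of the (r+1)×(r+1) integer matrix with columns v_{0 j_0}, v_{1 j_1}, …, v_{r j_r} has absolute value |μ(j_0, …, j_r)|, where μ(j_0, …, j_r) = Σ_{i₀=0}^{r} d_{i₀ j_{i₀}} · ∏_{i ≠ i₀} l_{i j_i}. -/
/-- The vector `e_i` in `ℤ^{r+1}`: for `1 ≤ i ≤ r` the standard basis vector `e_i`
(occupying coordinate `i - 1`), and `e_0 := -(e_1 + ⋯ + e_r)`.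
The last coordinate (index `r`) is reserved for `u`. -/
def eVec (r : ℕ) (i : Fin (r + 1)) : Fin (r + 1) → ℤ :=
  fun k => if (i : ℕ) = 0 then (if (k : ℕ) = r then 0 else -1)
           else (if (k : ℕ) + 1 = (i : ℕ) then 1 else 0)

/-- The vector `u` in `ℤ^{r+1}` (the last standard basis vector). -/
def uVec (r : ℕ) : Fin (r + 1) → ℤ := fun k => if (k : ℕ) = r then 1 else 0

/-- The column `v_{ij} = l_{ij}·e_i + d_{ij}·u`.  Block `i` has `n i + 1` columns,
so that block sizes range over all positive integers. -/
def colV (r : ℕ) (n : Fin (r + 1) → ℕ) (l d : (i : Fin (r + 1)) → Fin (n i + 1) → ℤ)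
    (i : Fin (r + 1)) (j : Fin (n i + 1)) : Fin (r + 1) → ℤ :=
  fun k => l i j * eVec r i k + d i j * uVec r k

/-- The sum of the columns `a i • e_i + b i • u`, weighted by the complementary products of the
`a i`, is a multiple of `u`. -/
theorem sum_prod_erase_mul_column (r : ℕ) (a b : Fin (r + 1) → ℤ) (k : Fin (r + 1)) :
    ∑ i, (∏ m ∈ Finset.univ.erase i, a m) * (a i * eVec r i k + b i * uVec r k)
      = (∑ i, b i * ∏ m ∈ Finset.univ.erase i, a m) * uVec r k := by
  have hprod (i : Fin (r + 1)) : (∏ m ∈ Finset.univ.erase i, a m) * a i = ∏ m, a m :=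
    Finset.prod_erase_mul _ _ (Finset.mem_univ i)
  have hsum : ∑ i, eVec r i k = 0 := by
    rw [Fin.sum_univ_succ]
    refine Fin.lastCases ?_ (fun k => ?_) k
    · simp only [eVec, Fin.val_succ, Fin.val_last, Fin.val_zero]
      simp only [if_true, zero_add]
      exact Finset.sum_eq_zero fun x _ => by simp [x.isLt.ne']
    · simp [eVec, Fin.val_inj, k.isLt.ne]
  calc _ = (∏ m, a m) * ∑ i, eVec r i k
        + (∑ i, b i * ∏ m ∈ Finset.univ.erase i, a m) * uVec r k := by
        rw [Finset.mul_sum, Finset.sum_mul, ← Finset.sum_add_distrib]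
        refine Finset.sum_congr rfl fun i _ => ?_
        rw [← hprod i]
        ring
    _ = _ := by rw [hsum, mul_zero, zero_add]

/-- The determinant, up to sign, of the matrix with columns `a i • e_i + b i • u`. -/
theorem abs_det_eVec_uVec (r : ℕ) (a b : Fin (r + 1) → ℤ) (ha : ∀ i, a i ≠ 0) :
    |(Matrix.of fun k i : Fin (r + 1) => a i * eVec r i k + b i * uVec r k).det|
      = |∑ i, b i * ∏ m ∈ Finset.univ.erase i, a m| := by
  set M := Matrix.of fun k i : Fin (r + 1) => a i * eVec r i k + b i * uVec r k with hM
  set μ := ∑ i, b i * ∏ m ∈ Finset.univ.erase i, a m with hμ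
  have hcol : (M.updateCol 0 fun k => μ * uVec r k).det
      = (∏ m ∈ Finset.univ.erase 0, a m) * M.det := by
    rw [← smul_eq_mul, ← Matrix.det_updateCol_sum M 0 fun i => ∏ m ∈ Finset.univ.erase i, a m]
    congr 2
    ext k
    simpa [hM] using (sum_prod_erase_mul_column r a b k).symm
  have hminor : M.submatrix Fin.castSucc Fin.succ = Matrix.diagonal fun i => a i.succ := by
    ext k i
    simp [hM, eVec, uVec, Matrix.diagonal_apply, k.isLt.ne, Fin.val_inj]
    grind
  have herase : ∏ m ∈ Finset.univ.erase 0, a m = ∏ i : Fin r, a i.succ := by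
    refine mul_left_cancel₀ (ha 0) ?_
    rw [Finset.mul_prod_erase _ _ (Finset.mem_univ 0), Fin.prod_univ_succ]
  have hexpand : (M.updateCol 0 fun k => μ * uVec r k).det
      = (-1) ^ r * μ * ∏ i : Fin r, a i.succ := by
    rw [Matrix.det_succ_column_zero, Fin.sum_univ_castSucc, Finset.sum_eq_zero, zero_add]
    · have hsub : (M.updateCol 0 fun k => μ * uVec r k).submatrix Fin.castSucc Fin.succ
          = M.submatrix Fin.castSucc Fin.succ := by
        ext; simp
      rw [Fin.succAbove_last, hsub, hminor, Matrix.det_diagonal]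
      simp [uVec]
    · intro k _
      simp [uVec, k.isLt.ne]
  have hne : ∏ i : Fin r, a i.succ ≠ 0 := Finset.prod_ne_zero_iff.2 fun i _ => ha _
  have hdet : M.det = (-1) ^ r * μ := by
    refine mul_left_cancel₀ hne ?_
    rw [← herase, ← hcol, hexpand, herase, mul_comm]
  rw [hdet, abs_mul, abs_pow, abs_neg, abs_one, one_pow, one_mul]

/-- for any choice of indices `j i` in each block, the determinant of the
`(r+1)×(r+1)` matrix with columns `v_{0 j₀}, …, v_{r j_r}` has absolute value
`|μ(j₀, …, j_r)| = |Σ_{i₀} d_{i₀ j_{i₀}} · Π_{i ≠ i₀} l_{i j_i}|`. -/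
theorem stmt1 (r : ℕ) (hr : 1 ≤ r) (n : Fin (r + 1) → ℕ)
    (l d : (i : Fin (r + 1)) → Fin (n i + 1) → ℤ)
    (hl : ∀ i j, 1 ≤ l i j)
    (hcop : ∀ i j, Int.gcd (l i j) (d i j) = 1)
    (j : (i : Fin (r + 1)) → Fin (n i + 1)) :
    |(Matrix.of (fun k i : Fin (r + 1) => colV r n l d i (j i) k)).det|
      = |∑ i₀ : Fin (r + 1), d i₀ (j i₀) * ∏ i ∈ Finset.univ.erase i₀, l i (j i)| := by
  exact abs_det_eVec_uVec r (fun i => l i (j i)) (fun i => d i (j i)) fun i =>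
    (zero_lt_one.trans_le (hl i (j i))).ne'
end

section
/- Let 0 ≤ i₀, i₁ ≤ r with i₀ ≠ i₁, let 1 ≤ j, j' ≤ n_{i₀} with j ≠ j', and choose j_i ∈ {1, …, n_i} for each i ∉ {i₀, i₁}. Then the determinant of the (r+1)×(r+1) integer matrix whose columns are v_{i₀ j}, v_{i₀ j'} and the columns v_{i j_i} for i ∉ {i₀, i₁} has absolute value |ν(i₀, j, j')| · ∏_{i ∉ {i₀, i₁}} l_{i j_i}, where ν(i₀, j, j') = l_{i₀ j} d_{i₀ j'} − l_{i₀ j'} d_{i₀ j}. -/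
/-- `ν(i, j, j') = l_{ij} d_{ij'} − l_{ij'} d_{ij}`. -/
def nuP (r : ℕ) (n : Fin (r + 1) → ℕ) (l d : (i : Fin (r + 1)) → Fin (n i + 1) → ℤ)
    (i : Fin (r + 1)) (j j' : Fin (n i + 1)) : ℤ :=
  l i j * d i j' - l i j' * d i j

/-- With the convention that coordinate `0` of `ℤ^{r+1}` vanishes, the coordinate `i` of `e_j` is
`δ_{ij} - δ_{j0}`. -/
theorem sum_ite_succ_eq_mul_eVec (r : ℕ) (i j : Fin (r + 1)) :
    ∑ k : Fin (r + 1), (if (k : ℕ) + 1 = (i : ℕ) then 1 else 0) * eVec r j k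
      = (if i = j then 1 else 0) - (if j = 0 then 1 else 0) := by
  by_cases hi : i = 0
  · subst hi
    simp [eq_comm]
  · have hi' : (i : ℕ) ≠ 0 := fun h => hi (Fin.ext h)
    have hlt := i.isLt
    rw [Finset.sum_eq_single (⟨(i : ℕ) - 1, by omega⟩ : Fin (r + 1))]
    · simp only [eVec, Fin.ext_iff, Fin.val_zero]
      split_ifs <;> omega
    · intro k _ hk
      rw [if_neg, zero_mul]
      intro h
      exact hk (Fin.ext (by simp only; omega))
    · simp

theorem sum_ite_succ_eq_mul_uVec (r : ℕ) (i : Fin (r + 1)) :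
    ∑ k : Fin (r + 1), (if (k : ℕ) + 1 = (i : ℕ) then 1 else 0) * uVec r k = 0 := by
  refine Finset.sum_eq_zero fun k _ => ?_
  have hlt := i.isLt
  simp only [uVec]
  split_ifs <;> omega

theorem sum_uVec_mul_eVec (r : ℕ) (j : Fin (r + 1)) :
    ∑ k : Fin (r + 1), uVec r k * eVec r j k = 0 := by
  refine Finset.sum_eq_zero fun k _ => ?_
  have hlt := j.isLt
  simp only [uVec, eVec]
  split_ifs <;> omega

theorem sum_uVec_mul_uVec (r : ℕ) : ∑ k : Fin (r + 1), uVec r k * uVec r k = 1 := by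
  rw [Finset.sum_eq_single (Fin.last r)]
  · simp [uVec]
  · intro k _ hk
    have : (k : ℕ) ≠ r := fun h => hk (Fin.ext h)
    simp [uVec, this]
  · simp

/-- The inverse of the matrix with column `u` in position `i₁` and columns `e_i` in the positions
`i ≠ i₁`. -/
def dualMatrix (r : ℕ) (i₁ : Fin (r + 1)) : Matrix (Fin (r + 1)) (Fin (r + 1)) ℤ :=
  Matrix.of fun i k =>
    if i = i₁ then uVec r k
    else (if (k : ℕ) + 1 = (i : ℕ) then 1 else 0) - (if (k : ℕ) + 1 = (i₁ : ℕ) then 1 else 0)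

theorem sum_dualMatrix_mul_eVec (r : ℕ) (i₁ i j : Fin (r + 1)) (hj : j ≠ i₁) :
    ∑ k, dualMatrix r i₁ i k * eVec r j k = if i = j then 1 else 0 := by
  by_cases hi : i = i₁
  · subst hi
    simp [dualMatrix, sum_uVec_mul_eVec r, hj.symm]
  · simp only [dualMatrix, Matrix.of_apply, if_neg hi, sub_mul, Finset.sum_sub_distrib,
      sum_ite_succ_eq_mul_eVec, if_neg hj.symm]
    ring

theorem sum_dualMatrix_mul_uVec (r : ℕ) (i₁ i : Fin (r + 1)) :
    ∑ k, dualMatrix r i₁ i k * uVec r k = if i = i₁ then 1 else 0 := by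
  by_cases hi : i = i₁
  · subst hi
    simp [dualMatrix, sum_uVec_mul_uVec]
  · simp only [dualMatrix, Matrix.of_apply, if_neg hi, sub_mul, Finset.sum_sub_distrib,
      sum_ite_succ_eq_mul_uVec, sub_zero]

theorem abs_det_dualMatrix (r : ℕ) (i₁ : Fin (r + 1)) :
    |(dualMatrix r i₁).det| = 1 := by
  have h : dualMatrix r i₁ * Matrix.of (fun k i => if i = i₁ then uVec r k else eVec r i k) = 1 := by
    ext i j
    rw [Matrix.mul_apply, Matrix.one_apply]
    by_cases hj : j = i₁
    · subst hj
      simpa using sum_dualMatrix_mul_uVec r j i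
    · simpa [hj] using sum_dualMatrix_mul_eVec r i₁ i j hj
  rw [← Int.isUnit_iff_abs_eq]
  exact IsUnit.of_mul_eq_one _ (by rw [← Matrix.det_mul, h, Matrix.det_one])

theorem sum_dualMatrix_mul_colV (r : ℕ) (n : Fin (r + 1) → ℕ)
    (l d : (i : Fin (r + 1)) → Fin (n i + 1) → ℤ) (i₁ i c : Fin (r + 1)) (hc : c ≠ i₁)
    (j : Fin (n c + 1)) :
    ∑ k, dualMatrix r i₁ i k * colV r n l d c j k
      = l c j * (if i = c then 1 else 0) + d c j * (if i = i₁ then 1 else 0) := by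
  rw [← sum_dualMatrix_mul_eVec r i₁ i c hc, ← sum_dualMatrix_mul_uVec r i₁ i,
    Finset.mul_sum, Finset.mul_sum, ← Finset.sum_add_distrib]
  refine Finset.sum_congr rfl fun k _ => ?_
  simp only [colV]
  ring

/-- The determinant of a matrix in which every row other than `p` and `q` vanishes off the
diagonal. -/
theorem Matrix.det_eq_mul_prod_of_rows_diagonal {m R : Type*} [Fintype m] [DecidableEq m] [CommRing R]
    (M : Matrix m m R) {p q : m} (hpq : p ≠ q)
    (hrow : ∀ i, i ≠ p → i ≠ q → ∀ j, i ≠ j → M i j = 0) :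
    M.det = (M p p * M q q - M p q * M q p) * ∏ i ∈ (Finset.univ.erase p).erase q, M i i := by
  rw [Matrix.twoBlockTriangular_det M (fun i => i = p ∨ i = q)]
  · congr 1
    · let e : Fin 2 ≃ {i // i = p ∨ i = q} :=
        Equiv.ofBijective ![⟨p, Or.inl rfl⟩, ⟨q, Or.inr rfl⟩] (by
          constructor
          · intro a b h
            fin_cases a <;> fin_cases b <;> simp_all [eq_comm]
          · rintro ⟨x, rfl | rfl⟩
            · exact ⟨0, rfl⟩
            · exact ⟨1, rfl⟩)
      rw [← Matrix.det_submatrix_equiv_self e, Matrix.det_fin_two]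
      rfl
    · have : M.toSquareBlockProp (fun i => ¬(i = p ∨ i = q))
          = Matrix.diagonal fun i => M i.1 i.1 := by
        ext ⟨i, hi⟩ ⟨j, hj⟩
        push Not at hi
        by_cases h : i = j
        · subst h
          simp [Matrix.toSquareBlockProp_def]
        · rw [Matrix.diagonal_apply_ne _ (by simpa using h)]
          exact hrow i hi.1 hi.2 j h
      rw [this, Matrix.det_diagonal]
      symm
      refine Finset.prod_subtype _ (fun x => ?_) fun i => M i i
      simp [and_comm]
  · intro i hi j hj
    push Not at hi
    refine hrow i hi.1 hi.2 j ?_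
    rintro rfl
    exact hj.elim hi.1 hi.2

/-- the determinant of the `(r+1)×(r+1)` matrix whose columns are
`v_{i₀ j}`, `v_{i₀ j'}` and the columns `v_{i j_i}` for `i ∉ {i₀, i₁}` has absolute value
`|ν(i₀, j, j')| · Π_{i ∉ {i₀,i₁}} l_{i j_i}`. -/
theorem stmt2 (r : ℕ) (hr : 1 ≤ r) (n : Fin (r + 1) → ℕ)
    (l d : (i : Fin (r + 1)) → Fin (n i + 1) → ℤ)
    (hl : ∀ i j, 1 ≤ l i j)
    (hcop : ∀ i j, Int.gcd (l i j) (d i j) = 1)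
    (i₀ i₁ : Fin (r + 1)) (h01 : i₀ ≠ i₁)
    (j j' : Fin (n i₀ + 1)) (hjj : j ≠ j')
    (jf : (i : Fin (r + 1)) → Fin (n i + 1)) :
    |(Matrix.of (fun k i : Fin (r + 1) =>
        if i = i₀ then colV r n l d i₀ j k
        else if i = i₁ then colV r n l d i₀ j' k
        else colV r n l d i (jf i) k)).det|
      = |nuP r n l d i₀ j j'| * ∏ i ∈ (Finset.univ.erase i₀).erase i₁, l i (jf i) := by
  set M := Matrix.of (fun k i : Fin (r + 1) =>
        if i = i₀ then colV r n l d i₀ j k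
        else if i = i₁ then colV r n l d i₀ j' k
        else colV r n l d i (jf i) k) with hM
  have hi₀ : ∀ i, (dualMatrix r i₁ * M) i i₀
      = l i₀ j * (if i = i₀ then 1 else 0) + d i₀ j * (if i = i₁ then 1 else 0) := fun i => by
    rw [Matrix.mul_apply, ← sum_dualMatrix_mul_colV r n l d i₁ i i₀ h01]
    simp [hM]
  have hi₁ : ∀ i, (dualMatrix r i₁ * M) i i₁
      = l i₀ j' * (if i = i₀ then 1 else 0) + d i₀ j' * (if i = i₁ then 1 else 0) := fun i => by
    rw [Matrix.mul_apply, ← sum_dualMatrix_mul_colV r n l d i₁ i i₀ h01]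
    simp [hM, h01.symm]
  have hne : ∀ i c, c ≠ i₀ → c ≠ i₁ → (dualMatrix r i₁ * M) i c
      = l c (jf c) * (if i = c then 1 else 0) + d c (jf c) * (if i = i₁ then 1 else 0) := by
    intro i c h0 h1
    rw [Matrix.mul_apply, ← sum_dualMatrix_mul_colV r n l d i₁ i c h1]
    simp [hM, h0, h1]
  have hdet : (dualMatrix r i₁ * M).det
      = nuP r n l d i₀ j j' * ∏ i ∈ (Finset.univ.erase i₀).erase i₁, l i (jf i) := by
    rw [Matrix.det_eq_mul_prod_of_rows_diagonal _ h01]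
    · congr 1
      · simp [hi₀, hi₁, h01, h01.symm, nuP]
      · refine Finset.prod_congr rfl fun i hi => ?_
        simp only [Finset.mem_erase, Finset.mem_univ, and_true] at hi
        simp [hne i i hi.2 hi.1, hi.1]
    · intro i h0 h1 c hc
      by_cases hc0 : c = i₀
      · simp [hc0, hi₀, h0, h1]
      · by_cases hc1 : c = i₁
        · simp [hc1, hi₁, h0, h1]
        · simp [hne i c hc0 hc1, hc, h1]
  have hprod : 0 ≤ ∏ i ∈ (Finset.univ.erase i₀).erase i₁, l i (jf i) :=
    Finset.prod_nonneg fun i _ => zero_le_one.trans (hl i (jf i))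
  rw [← abs_of_nonneg hprod, ← abs_mul, ← hdet, Matrix.det_mul, abs_mul,
    abs_det_dualMatrix r, one_mul]
end

section
/- Let P be a defining matrix of any type and let A be a set of r+1 columns of P none of which is one of the appended columns u, −u, and assume det(P_A) ≠ 0. Then exactly one of the following holds: (i) A contains exactly one column v_{i j_i} from each block i = 0, …, r, and |det(P_A)| = |μ(j_0, …, j_r)|; (ii) there exist i₀ ≠ i₁ in {0, …, r} such that A contains exactly two columns v_{i₀ j}, v_{i₀ j'} from block i₀, no column from block i₁, and exactly one column v_{i j_i} from every other block i, and |det(P_A)| = |ν(i₀, j, j')| · ∏_{i ∉ {i₀, i₁}} l_{i j_i}. -/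
/-- All columns of a defining matrix: block columns `v_{ij}` together with
`m` appended columns (`m = 0,1,2` according to the types (ee), (pe)/(ep), (pp)). -/
def colOf (r : ℕ) (n : Fin (r + 1) → ℕ) (l d : (i : Fin (r + 1)) → Fin (n i + 1) → ℤ)
    (m : ℕ) (ext : Fin m → Fin (r + 1) → ℤ) :
    ((i : Fin (r + 1)) × Fin (n i + 1)) ⊕ Fin m → Fin (r + 1) → ℤ :=
  Sum.elim (fun p => colV r n l d p.1 p.2) ext

/-- `μ(j₀, …, j_r) = Σ_{i₀} d_{i₀ j_{i₀}} · Π_{i ≠ i₀} l_{i j_i}`. -/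
def muP (r : ℕ) (n : Fin (r + 1) → ℕ) (l d : (i : Fin (r + 1)) → Fin (n i + 1) → ℤ)
    (j : (i : Fin (r + 1)) → Fin (n i + 1)) : ℤ :=
  ∑ i₀ : Fin (r + 1), d i₀ (j i₀) * ∏ i ∈ Finset.univ.erase i₀, l i (j i)

/-- The vectors `e_0, …, e_r` sum to zero. -/
theorem sum_eVec (r : ℕ) : ∑ i, eVec r i = 0 := by
  ext k
  rw [Finset.sum_apply, Fin.sum_univ_succ]
  induction k using Fin.lastCases with
  | last =>
    have h : ∀ i : Fin r, r ≠ (i : ℕ) := fun i => by omega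
    simp [eVec, h]
  | cast k =>
    have h : (k : ℕ) ≠ r := by omega
    simp [eVec, h, ← Fin.ext_iff]

theorem eVec_succ (r : ℕ) (k : Fin r) : eVec r k.succ = Pi.single k.castSucc 1 := by
  ext x
  simp [eVec, Pi.single_apply, Fin.ext_iff]

theorem uVec_eq_single (r : ℕ) : uVec r = Pi.single (Fin.last r) 1 := by
  ext x
  simp [uVec, Pi.single_apply, Fin.ext_iff]

/-- A linear functional vanishing on `u` with prescribed values of sum zero on the `e_i`. -/
theorem exists_dotProduct_eVec (r : ℕ) (a : Fin (r + 1) → ℤ) (ha : ∑ i, a i = 0) :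
    ∃ x : Fin (r + 1) → ℤ, (∀ i, eVec r i ⬝ᵥ x = a i) ∧ uVec r ⬝ᵥ x = 0 := by
  let x : Fin (r + 1) → ℤ := Fin.snoc (α := fun _ => ℤ) (fun k : Fin r => a k.succ) 0
  have hs : ∀ k : Fin r, eVec r k.succ ⬝ᵥ x = a k.succ := fun k => by
    simp [eVec_succ, x]
  refine ⟨x, fun i => ?_, by simp [uVec_eq_single, x]⟩
  induction i using Fin.cases with
  | succ k => exact hs k
  | zero =>
    have h := congrArg (fun v => v ⬝ᵥ x) (sum_eVec r)
    simp only [sum_dotProduct, zero_dotProduct] at h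
    rw [Fin.sum_univ_succ] at h ha
    simp only [hs] at h
    linarith

/-- `u` together with all but one of the `e_i` is a lattice basis. -/
theorem abs_det_eVec_uVec_s3 (r : ℕ) (b : Fin (r + 1) → Fin (r + 1)) (t₁ i₁ : Fin (r + 1))
    (hb : ∀ i, i ≠ i₁ → ∃ t, t ≠ t₁ ∧ b t = i) :
    |(Matrix.of fun t => if t = t₁ then uVec r else eVec r (b t)).det| = 1 := by
  set v : Fin (r + 1) → Fin (r + 1) → ℤ :=
    fun t => if t = t₁ then uVec r else eVec r (b t) with hv
  have hrow : ∀ t, v t ∈ Submodule.span ℤ (Set.range v) :=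
    fun t => Submodule.subset_span ⟨t, rfl⟩
  have hu : uVec r ∈ Submodule.span ℤ (Set.range v) := by
    simpa [hv] using hrow t₁
  have hne : ∀ i, i ≠ i₁ → eVec r i ∈ Submodule.span ℤ (Set.range v) := by
    intro i hi
    obtain ⟨t, ht, rfl⟩ := hb i hi
    simpa [hv, ht] using hrow t
  have he : ∀ i, eVec r i ∈ Submodule.span ℤ (Set.range v) := by
    intro i
    by_cases hi : i = i₁
    · have h := sum_eVec r
      rw [← Finset.add_sum_erase _ _ (Finset.mem_univ i)] at h
      rw [eq_neg_of_add_eq_zero_left h]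
      refine Submodule.neg_mem _ (Submodule.sum_mem _ fun x hx => hne x ?_)
      exact hi ▸ Finset.ne_of_mem_erase hx
    · exact hne i hi
  have hsingle : ∀ k, ∃ c : Fin (r + 1) → ℤ, ∑ t, c t • v t = Pi.single k 1 := by
    intro k
    rw [← Submodule.mem_span_range_iff_exists_fun]
    induction k using Fin.lastCases with
    | last => exact uVec_eq_single r ▸ hu
    | cast k => exact eVec_succ r k ▸ he k.succ
  choose N hN using hsingle
  have hmul : Matrix.of N * Matrix.of v = 1 := by
    ext k x
    have h := congrFun (hN k) x
    simp only [Finset.sum_apply, Pi.smul_apply, smul_eq_mul] at h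
    rw [Matrix.mul_apply, Matrix.one_apply]
    simpa [Pi.single_apply, eq_comm] using h
  rw [← Int.isUnit_iff_abs_eq]
  refine IsUnit.of_mul_eq_one (Matrix.of N).det ?_
  rw [mul_comm, ← Matrix.det_mul, hmul, Matrix.det_one]

/-- A relation `∑ w_t v_t = c u` among the rows `v_t = l_t e_{b t} + d_t u` determines the
determinant up to sign. -/
theorem abs_mul_det_of_sum_eq (r : ℕ) (b : Fin (r + 1) → Fin (r + 1))
    (L D w : Fin (r + 1) → ℤ) (c : ℤ) (t₁ i₁ : Fin (r + 1))
    (hb : ∀ i, i ≠ i₁ → ∃ t, t ≠ t₁ ∧ b t = i)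
    (hw : ∑ t, w t • (L t • eVec r (b t) + D t • uVec r) = c • uVec r) :
    |w t₁ * (Matrix.of fun t => L t • eVec r (b t) + D t • uVec r).det| =
      |c| * |∏ t ∈ Finset.univ.erase t₁, L t| := by
  set M : Matrix (Fin (r + 1)) (Fin (r + 1)) ℤ :=
    Matrix.of fun t => L t • eVec r (b t) + D t • uVec r with hM
  set R : Matrix (Fin (r + 1)) (Fin (r + 1)) ℤ :=
    Matrix.of fun t => if t = t₁ then uVec r else eVec r (b t) with hR
  have h1 : w t₁ * M.det = c * (M.updateRow t₁ (uVec r)).det := by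
    rw [← smul_eq_mul, ← Matrix.det_updateRow_sum M t₁ w, ← Matrix.det_updateRow_smul]
    exact congrArg (fun v => (M.updateRow t₁ v).det) hw
  let L' : Fin (r + 1) → ℤ := Function.update L t₁ 1
  have h2 : (M.updateRow t₁ (uVec r)).det = (Matrix.of fun t k => L' t * R t k).det := by
    refine Matrix.det_eq_of_forall_row_eq_smul_add_const (Function.update D t₁ 0) t₁
      (by simp) fun t k => ?_
    by_cases ht : t = t₁
    · subst ht
      simp [hR, L']
    · simp [hR, hM, L', ht]
  have h3 : ∏ t, L' t = ∏ t ∈ Finset.univ.erase t₁, L t := by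
    rw [← Finset.mul_prod_erase _ _ (Finset.mem_univ t₁)]
    simp only [L', Function.update_self, one_mul]
    exact Finset.prod_congr rfl fun t ht =>
      Function.update_of_ne (Finset.ne_of_mem_erase ht) _ _
  rw [h1, h2, Matrix.det_mul_column, h3, abs_mul, abs_mul,
    abs_det_eVec_uVec_s3 r b t₁ i₁ hb, mul_one]

/-- If two blocks are missed, the determinant vanishes. -/
theorem det_eq_zero_of_two_missing (r : ℕ) (b : Fin (r + 1) → Fin (r + 1))
    (L D : Fin (r + 1) → ℤ) (i₁ i₂ : Fin (r + 1)) (hne : i₁ ≠ i₂)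
    (h₁ : ∀ t, b t ≠ i₁) (h₂ : ∀ t, b t ≠ i₂) :
    (Matrix.of fun t => L t • eVec r (b t) + D t • uVec r).det = 0 := by
  obtain ⟨x, hx, hxu⟩ := exists_dotProduct_eVec r (Pi.single i₁ 1 - Pi.single i₂ 1)
    (by simp [Finset.sum_sub_distrib])
  rw [← Matrix.exists_mulVec_eq_zero_iff]
  refine ⟨x, ?_, ?_⟩
  · rintro rfl
    have := hx i₁
    simp [hne] at this
  · ext t
    change (L t • eVec r (b t) + D t • uVec r) ⬝ᵥ x = 0
    rw [add_dotProduct, smul_dotProduct, smul_dotProduct, hx, hxu]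
    simp [h₁ t, h₂ t]

/-- let `A` be a set of `r+1` columns of a defining matrix `P` (of any type),
none of which is an appended column `u`, `-u`, and with `det(P_A) ≠ 0`.  Then exactly one
of the following holds:
(i) `A` consists of exactly one column `v_{i j_i}` from each block, and
    `|det(P_A)| = |μ(j₀, …, j_r)|`;
(ii) there are `i₀ ≠ i₁` such that `A` contains exactly two columns `v_{i₀ j}, v_{i₀ j'}`
    from block `i₀`, no column from block `i₁` and exactly one column from every other
    block, and `|det(P_A)| = |ν(i₀, j, j')| · Π_{i ∉ {i₀,i₁}} l_{i j_i}`. -/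
theorem stmt3 (r : ℕ) (hr : 1 ≤ r) (n : Fin (r + 1) → ℕ)
    (l d : (i : Fin (r + 1)) → Fin (n i + 1) → ℤ)
    (hl : ∀ i j, 1 ≤ l i j)
    (hcop : ∀ i j, Int.gcd (l i j) (d i j) = 1)
    (hslope : ∀ (i : Fin (r + 1)) (j j' : Fin (n i + 1)), j < j' →
      (d i j' : ℚ) / (l i j' : ℚ) < (d i j : ℚ) / (l i j : ℚ))
    (m : ℕ) (hm : m ≤ 2)
    (ext : Fin m → Fin (r + 1) → ℤ)
    (hext : ∀ s, ext s = uVec r ∨ ext s = -uVec r)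
    (hextinj : Function.Injective ext)
    (hcone : ∀ x : Fin (r + 1) → ℚ,
      ∃ c : ((i : Fin (r + 1)) × Fin (n i + 1)) ⊕ Fin m → ℚ,
        (∀ a, 0 ≤ c a) ∧ ∀ k, x k = ∑ a, c a * ((colOf r n l d m ext a k : ℤ) : ℚ))
    (A : Fin (r + 1) → ((i : Fin (r + 1)) × Fin (n i + 1)) ⊕ Fin m)
    (hA : Function.Injective A)
    (hnoext : ∀ t, ∃ p : (i : Fin (r + 1)) × Fin (n i + 1), A t = Sum.inl p)
    (hdet : (Matrix.of (fun k t : Fin (r + 1) => colOf r n l d m ext (A t) k)).det ≠ 0) :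
    Xor'
      (∃ (j : (i : Fin (r + 1)) → Fin (n i + 1)) (σ : Equiv.Perm (Fin (r + 1))),
        (∀ t, A t = Sum.inl ⟨σ t, j (σ t)⟩) ∧
        |(Matrix.of (fun k t : Fin (r + 1) => colOf r n l d m ext (A t) k)).det|
          = |muP r n l d j|)
      (∃ (i₀ i₁ : Fin (r + 1)), i₀ ≠ i₁ ∧
        ∃ (jj jj' : Fin (n i₀ + 1)), jj ≠ jj' ∧
        ∃ jf : (i : Fin (r + 1)) → Fin (n i + 1),
          Set.range A =
            insert (Sum.inl ⟨i₀, jj⟩) (insert (Sum.inl ⟨i₀, jj'⟩)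
              ((fun i => (Sum.inl ⟨i, jf i⟩ :
                  ((i : Fin (r + 1)) × Fin (n i + 1)) ⊕ Fin m)) '' {i | i ≠ i₀ ∧ i ≠ i₁})) ∧
          |(Matrix.of (fun k t : Fin (r + 1) => colOf r n l d m ext (A t) k)).det|
            = |nuP r n l d i₀ jj jj'| * ∏ i ∈ (Finset.univ.erase i₀).erase i₁, l i (jf i)) := by
  choose p hp using hnoext
  have hpinj : Function.Injective p := fun s t h => hA (by rw [hp, hp, h])
  set b : Fin (r + 1) → Fin (r + 1) := fun t => (p t).1 with hb
  set L : Fin (r + 1) → ℤ := fun t => l (p t).1 (p t).2 with hL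
  set D : Fin (r + 1) → ℤ := fun t => d (p t).1 (p t).2 with hD
  have hLpos : ∀ t, 0 < L t := fun t => hl _ _
  have hmat : (Matrix.of (fun k t : Fin (r + 1) => colOf r n l d m ext (A t) k)).det =
      (Matrix.of fun t => L t • eVec r (b t) + D t • uVec r).det := by
    rw [← Matrix.det_transpose]
    congr 1
    ext t k
    simp [hp, colOf, colV, hL, hD, hb]
  rw [hmat] at hdet ⊢
  refine (xor_iff_or_and_not_and _ _).mpr ⟨?_, ?_⟩
  · by_cases hsurj : Function.Surjective b
    · left
      have hbij : Function.Bijective b := ⟨Finite.injective_iff_surjective.mpr hsurj, hsurj⟩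
      have hex : ∀ i, ∃ j, ∃ t, p t = ⟨i, j⟩ := fun i => by
        obtain ⟨t, rfl⟩ := hsurj i
        exact ⟨(p t).2, t, rfl⟩
      choose j s hs using hex
      have hpt : ∀ t, p t = ⟨b t, j (b t)⟩ := fun t => by
        have h : s (b t) = t := hbij.1 (by simp only [hb, hs])
        rw [← hs (b t), h]
      refine ⟨j, Equiv.ofBijective b hbij, fun t => by rw [hp, hpt t]; rfl, ?_⟩
      have hLj : ∀ t, L t = l (b t) (j (b t)) := fun t => by
        simp only [hL]
        rw [hpt t]
      have hDj : ∀ t, D t = d (b t) (j (b t)) := fun t => by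
        simp only [hD]
        rw [hpt t]
      let w : Fin (r + 1) → ℤ := fun t => ∏ t' ∈ Finset.univ.erase t, L t'
      have hwpos : ∀ t, 0 < w t := fun t => Finset.prod_pos fun t' _ => hLpos t'
      have hwb : ∀ t, w t = ∏ i ∈ Finset.univ.erase (b t), l i (j i) := fun t => by
        refine Finset.prod_bij (fun t' _ => b t') ?_ ?_ ?_ ?_
        · intro t' ht'
          simpa [hbij.1.eq_iff] using ht'
        · intro x _ y _ h
          exact hbij.1 h
        · intro i hi
          obtain ⟨t', rfl⟩ := hsurj i
          exact ⟨t', by simpa [hbij.1.eq_iff] using hi, rfl⟩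
        · intro t' _
          exact hLj t'
      have hmu : muP r n l d j = ∑ t, w t * D t := by
        rw [muP, ← (Equiv.ofBijective b hbij).sum_comp]
        refine Finset.sum_congr rfl fun t _ => ?_
        rw [hwb, hDj, mul_comm]
        rfl
      have hsum : ∑ t, w t • (L t • eVec r (b t) + D t • uVec r) =
          muP r n l d j • uVec r := by
        have hprod : ∀ t, w t * L t = ∏ t', L t' := fun t =>
          Finset.prod_erase_mul _ _ (Finset.mem_univ t)
        simp only [smul_add, smul_smul, Finset.sum_add_distrib, hprod]
        rw [← Finset.smul_sum, ← Finset.sum_smul, ← hmu,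
          hbij.sum_comp (eVec r), sum_eVec, smul_zero, zero_add]
      have key := abs_mul_det_of_sum_eq r b L D w _ 0 (b 0) (fun i hi => by
        obtain ⟨t, rfl⟩ := hsurj i
        exact ⟨t, fun h => hi (by rw [h]), rfl⟩) hsum
      rw [abs_mul, mul_comm] at key
      exact mul_right_cancel₀ (abs_pos.mpr (hwpos 0).ne').ne' key
    · right
      obtain ⟨i₁, hi₁⟩ : ∃ i₁, ∀ t, b t ≠ i₁ := by
        simpa [Function.Surjective] using hsurj
      have hhit : ∀ i, i ≠ i₁ → ∃ t, b t = i := by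
        intro i hi
        by_contra! h
        exact hdet (det_eq_zero_of_two_missing r b L D i i₁ hi h hi₁)
      obtain ⟨t₀, t₁, hbt, ht⟩ : ∃ t₀ t₁, b t₀ = b t₁ ∧ t₀ ≠ t₁ := by
        have h : ¬ Function.Injective b := mt Finite.injective_iff_surjective.mp hsurj
        simpa [Function.Injective] using h
      have hhit' : ∀ i, i ≠ i₁ → ∃ t, t ≠ t₁ ∧ b t = i := by
        intro i hi
        obtain ⟨t, rfl⟩ := hhit i hi
        by_cases h : t = t₁
        · exact ⟨t₀, ht, h ▸ hbt⟩
        · exact ⟨t, h, rfl⟩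
      have hinj : ∀ s t, s ≠ t₁ → t ≠ t₁ → b s = b t → s = t := by
        have h : Function.Injective (Function.update b t₁ i₁) := by
          rw [Finite.injective_iff_surjective]
          intro i
          by_cases hi : i = i₁
          · exact ⟨t₁, by simp [hi]⟩
          · obtain ⟨t, h, rfl⟩ := hhit' i hi
            exact ⟨t, by simp [h]⟩
        intro s t hs ht h'
        exact h (by simpa [hs, ht] using h')
      have hex : ∀ i, ∃ j, i ≠ i₁ → ∃ t, t ≠ t₁ ∧ p t = ⟨i, j⟩ := fun i => by
        by_cases hi : i = i₁
        · exact ⟨0, fun h => (h hi).elim⟩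
        · obtain ⟨t, h, rfl⟩ := hhit' i hi
          exact ⟨(p t).2, fun _ => ⟨t, h, rfl⟩⟩
      choose jf hjf using hex
      have hpt : ∀ t, t ≠ t₁ → p t = ⟨b t, jf (b t)⟩ := fun t h => by
        obtain ⟨s, hs, hps⟩ := hjf (b t) (hi₁ t)
        have : s = t := hinj s t hs h (by simp only [hb, hps])
        rw [← hps, this]
      have hp₁ : ∃ j', p t₁ = ⟨b t₀, j'⟩ := by
        rw [hbt]
        exact ⟨_, rfl⟩
      obtain ⟨j', hj'⟩ := hp₁
      have hp₀ := hpt t₀ ht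
      have hne₀ : ∀ t, t ≠ t₀ → t ≠ t₁ → b t ≠ b t₀ := fun t h₀ h₁ h =>
        h₀ (hinj t t₀ h₁ ht h)
      refine ⟨b t₀, i₁, hi₁ t₀, jf (b t₀), j', ?_, jf, ?_, ?_⟩
      · intro h
        exact ht (hpinj (by rw [hp₀, hj', h]))
      · ext a
        constructor
        · rintro ⟨t, rfl⟩
          by_cases h₀ : t = t₀
          · left
            rw [h₀, hp, hp₀]
          by_cases h₁ : t = t₁
          · right; left
            rw [h₁, hp, hj']
          right; right
          exact ⟨b t, ⟨hne₀ t h₀ h₁, hi₁ t⟩, by rw [hp, hpt t h₁]⟩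
        · rintro (rfl | rfl | ⟨i, ⟨-, hi⟩, rfl⟩)
          · exact ⟨t₀, by rw [hp, hp₀]⟩
          · exact ⟨t₁, by rw [hp, hj']⟩
          · obtain ⟨t, -, h⟩ := hjf i hi
            exact ⟨t, by rw [hp, h]⟩
      · have hL₀ : L t₀ = l (b t₀) (jf (b t₀)) := by
          simp only [hL]
          rw [hp₀]
        have hD₀ : D t₀ = d (b t₀) (jf (b t₀)) := by
          simp only [hD]
          rw [hp₀]
        have hL₁ : L t₁ = l (b t₀) j' := by
          simp only [hL]
          rw [hj']
        have hD₁ : D t₁ = d (b t₀) j' := by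
          simp only [hD]
          rw [hj']
        have hsum : ∑ t, (Pi.single t₁ (L t₀) - Pi.single t₀ (L t₁) : Fin (r + 1) → ℤ) t •
            (L t • eVec r (b t) + D t • uVec r) =
              nuP r n l d (b t₀) (jf (b t₀)) j' • uVec r := by
          simp only [Pi.sub_apply, sub_smul, Finset.sum_sub_distrib, Pi.single_apply, ite_smul,
            zero_smul, Finset.sum_ite_eq', Finset.mem_univ, if_true]
          rw [nuP, ← hL₀, ← hD₀, ← hL₁, ← hD₁, ← hbt]
          module
        have key := abs_mul_det_of_sum_eq r b L D _ _ t₁ i₁ hhit' hsum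
        have hprod : ∏ t ∈ Finset.univ.erase t₁, L t =
            L t₀ * ∏ i ∈ (Finset.univ.erase (b t₀)).erase i₁, l i (jf i) := by
          rw [← Finset.mul_prod_erase (Finset.univ.erase t₁) _ (by simpa using ht : t₀ ∈ _)]
          congr 1
          refine Finset.prod_bij (fun t _ => b t) ?_ ?_ ?_ ?_
          · intro t h
            simp only [Finset.mem_erase, Finset.mem_univ, and_true] at h ⊢
            exact ⟨hi₁ t, hne₀ t h.1 h.2⟩
          · intro x hx y hy h
            simp only [Finset.mem_erase, Finset.mem_univ, and_true] at hx hy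
            exact hinj x y hx.2 hy.2 h
          · intro i hi
            simp only [Finset.mem_erase, Finset.mem_univ, and_true] at hi
            obtain ⟨t, h, rfl⟩ := hhit' i hi.1
            exact ⟨t, by simpa [h] using fun h' => hi.2 (by rw [h']), rfl⟩
          · intro t h
            simp only [Finset.mem_erase, Finset.mem_univ, and_true] at h
            simp only [hL]
            rw [hpt t h.2]
        have hpos : 0 < ∏ i ∈ (Finset.univ.erase (b t₀)).erase i₁, l i (jf i) :=
          Finset.prod_pos fun i _ => hl i (jf i)
        rw [hprod, abs_mul, abs_mul, abs_of_pos hpos] at key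
        simp only [Pi.sub_apply, Pi.single_eq_same, Pi.single_eq_of_ne ht.symm, sub_zero] at key
        refine mul_left_cancel₀ (abs_pos.mpr (hLpos t₀).ne').ne' (key.trans ?_)
        ring
  · rintro ⟨⟨j, σ, hσ, -⟩, i₀, i₁, hne, jj, jj', -, jf, hrange, -⟩
    have h : A (σ.symm i₁) ∈ Set.range A := ⟨_, rfl⟩
    rw [hrange, hσ] at h
    have hf : ∀ {i j i' j'}, (Sum.inl ⟨i, j⟩ : ((i : Fin (r + 1)) × Fin (n i + 1)) ⊕ Fin m) =
        Sum.inl ⟨i', j'⟩ → i = i' := fun h => congrArg Sigma.fst (Sum.inl.inj h)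
    rcases h with h | h | ⟨i, ⟨-, hi⟩, h⟩
    · exact hne (by simpa using (hf h).symm)
    · exact hne (by simpa using (hf h).symm)
    · exact hi (by simpa using hf h)
end

section
/- Let P be a defining matrix of type (pe), (ep) or (pp), and let A be a set of r+1 columns of P containing at least one of the appended columns u, −u, and assume det(P_A) ≠ 0. Then A contains exactly one appended column, and there exists an index i₁ ∈ {0, …, r} such that A contains no column from block i₁ and exactly one column v_{i j_i} from each block i ≠ i₁; moreover |det(P_A)| = ∏_{i ≠ i₁} l_{i j_i}. -/
namespace DefiningMatrix

variable {r : ℕ}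

theorem sum_eVec (k : Fin (r + 1)) : ∑ i, eVec r i k = 0 := by
  rw [Fin.sum_univ_succ]
  by_cases hk : (k : ℕ) = r
  · refine add_eq_zero_iff_eq_neg.2 ?_
    rw [Finset.sum_eq_zero fun i _ => ?_]
    · simp [eVec, hk]
    · have := i.isLt
      have hne : ¬ (k : ℕ) + 1 = (i : ℕ) + 1 := by omega
      simpa [eVec] using hne
  · have hlt : (k : ℕ) < r := by omega
    rw [Finset.sum_eq_single (⟨k, hlt⟩ : Fin r)]
    · simp [eVec, hk]
    · intro i _ hi
      have hne : ¬ (k : ℕ) = (i : ℕ) := fun h => hi (Fin.ext h.symm)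
      simp [eVec, hne]
    · simp

/-- The matrix with columns `e_i` for `i ≠ i₁` and `u` at position `i₁`. -/
def basisMatrix (r : ℕ) (i₁ : Fin (r + 1)) : Matrix (Fin (r + 1)) (Fin (r + 1)) ℤ :=
  Matrix.of fun k i => if i = i₁ then uVec r k else eVec r i k

/-- The inverse of `basisMatrix r i₁`, using `e_{i₁} = -∑_{i ≠ i₁} e_i`. -/
def basisMatrixInv (r : ℕ) (i₁ : Fin (r + 1)) : Matrix (Fin (r + 1)) (Fin (r + 1)) ℤ :=
  Matrix.of fun i k =>
    if (k : ℕ) = r then (if i = i₁ then 1 else 0)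
    else if i = i₁ then 0
    else (if (i : ℕ) = k + 1 then 1 else 0) - (if (i₁ : ℕ) = k + 1 then 1 else 0)

theorem basisMatrix_mul_inv (i₁ : Fin (r + 1)) :
    basisMatrix r i₁ * basisMatrixInv r i₁ = 1 := by
  ext k k'
  rw [Matrix.mul_apply, Matrix.one_apply]
  by_cases hk' : (k' : ℕ) = r
  · have h : ∀ i, basisMatrix r i₁ k i * basisMatrixInv r i₁ i k'
        = if i = i₁ then uVec r k else 0 := by
      intro i
      by_cases hi : i = i₁ <;> simp [basisMatrix, basisMatrixInv, hi, hk']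
    simp only [h, Finset.sum_ite_eq', Finset.mem_univ, if_true]
    simp [uVec, Fin.ext_iff, hk']
  · obtain ⟨m, hm⟩ : ∃ m : Fin (r + 1), (m : ℕ) = k' + 1 := ⟨⟨k' + 1, by omega⟩, rfl⟩
    have h : ∀ i, basisMatrix r i₁ k i * basisMatrixInv r i₁ i k'
        = (if i = m then eVec r i k else 0) - (if i₁ = m then 1 else 0) * eVec r i k := by
      intro i
      by_cases hi : i = i₁
      · simp [basisMatrixInv, hk', hi]
      · simp only [basisMatrix, basisMatrixInv, hk', hi, Matrix.of_apply, if_false, ← hm,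
          ← Fin.ext_iff]
        split_ifs <;> ring
    simp only [h, Finset.sum_sub_distrib, ← Finset.mul_sum, sum_eVec, mul_zero, sub_zero,
      Finset.sum_ite_eq', Finset.mem_univ, if_true]
    simp only [eVec, hm, Nat.add_one_ne_zero, if_false, Nat.add_right_cancel_iff, Fin.ext_iff]

theorem abs_det_basisMatrix (i₁ : Fin (r + 1)) : |(basisMatrix r i₁).det| = 1 := by
  have h := congrArg Matrix.det (basisMatrix_mul_inv i₁)
  rw [Matrix.det_mul, Matrix.det_one] at h
  exact Int.isUnit_iff_abs_eq.1 (IsUnit.of_mul_eq_one _ h)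

theorem abs_det_of_blocks (i₁ : Fin (r + 1)) (l d : Fin (r + 1) → ℤ) (hl : ∀ i, 0 ≤ l i)
    (w : Fin (r + 1) → ℤ) (hw : w = uVec r ∨ w = -uVec r) :
    |(Matrix.of fun k i => if i = i₁ then w k else l i * eVec r i k + d i * uVec r k).det|
      = ∏ i ∈ Finset.univ.erase i₁, l i := by
  obtain ⟨ε, hε, rfl⟩ : ∃ ε : ℤ, |ε| = 1 ∧ w = ε • uVec r := by
    rcases hw with rfl | rfl
    · exact ⟨1, by simp⟩
    · exact ⟨-1, by simp⟩
  have hεε : ε * ε = 1 := by rw [← abs_mul_abs_self, hε, one_mul]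
  let c : Fin (r + 1) → ℤ := fun i => if i = i₁ then ε else l i
  have hdet : (Matrix.of fun k i =>
      if i = i₁ then (ε • uVec r) k else l i * eVec r i k + d i * uVec r k).det
      = (Matrix.of fun k i => c i * basisMatrix r i₁ k i).det := by
    rw [← Matrix.det_transpose, ← Matrix.det_transpose (Matrix.of fun k i => c i * basisMatrix r i₁ k i)]
    refine Matrix.det_eq_of_forall_row_eq_smul_add_const
      (fun i => if i = i₁ then 0 else ε * d i) i₁ (by simp) fun i k => ?_
    by_cases hi : i = i₁
    · simp [hi, c, basisMatrix]
    · simp only [hi, c, basisMatrix, Matrix.transpose_apply, Matrix.of_apply, if_true, if_false]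
      linear_combination -(d i * uVec r k) * hεε
  rw [hdet, Matrix.det_mul_row, abs_mul, abs_det_basisMatrix, mul_one, Finset.abs_prod,
    ← Finset.mul_prod_erase _ _ (Finset.mem_univ i₁)]
  simp only [c, if_true, hε, one_mul]
  refine Finset.prod_congr rfl fun i hi => ?_
  rw [if_neg (Finset.ne_of_mem_erase hi), abs_of_nonneg (hl i)]

theorem det_eq_zero_of_col_combination {ι R : Type*} [Fintype ι] [DecidableEq ι] [CommRing R]
    [IsDomain R] (M : Matrix ι ι R) {t t' t₀ : ι} (ht' : t ≠ t') (ht₀ : t ≠ t₀) {a b c : R}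
    (ha : a ≠ 0) (h : ∀ k, a * M k t = b * M k t' + c * M k t₀) : M.det = 0 := by
  refine Matrix.exists_mulVec_eq_zero_iff.1
    ⟨Pi.single t a - Pi.single t' b - Pi.single t₀ c, fun h0 => ha ?_, ?_⟩
  · simpa [ht', ht₀] using congrFun h0 t
  · ext k
    simp only [Matrix.mulVec_sub, Matrix.mulVec_single, Pi.sub_apply, Pi.smul_apply,
      MulOpposite.smul_eq_mul_unop, MulOpposite.unop_op, Matrix.col_apply, Pi.zero_apply]
    linear_combination h k

end DefiningMatrix

open DefiningMatrix


/-- let `P` be a defining matrix of type (pe), (ep) or (pp) and `A` a set of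
`r+1` columns of `P` containing at least one appended column, with `det(P_A) ≠ 0`.  Then
`A` contains exactly one appended column, and there is a block `i₁` such that `A` contains
no column from block `i₁` and exactly one column `v_{i j_i}` from each block `i ≠ i₁`;
moreover `|det(P_A)| = Π_{i ≠ i₁} l_{i j_i}`. -/
theorem stmt4 (r : ℕ) (hr : 1 ≤ r) (n : Fin (r + 1) → ℕ)
    (l d : (i : Fin (r + 1)) → Fin (n i + 1) → ℤ)
    (hl : ∀ i j, 1 ≤ l i j)
    (hcop : ∀ i j, Int.gcd (l i j) (d i j) = 1)
    (hslope : ∀ (i : Fin (r + 1)) (j j' : Fin (n i + 1)), j < j' →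
      (d i j' : ℚ) / (l i j' : ℚ) < (d i j : ℚ) / (l i j : ℚ))
    (m : ℕ) (hm1 : 1 ≤ m) (hm2 : m ≤ 2)
    (ext : Fin m → Fin (r + 1) → ℤ)
    (hext : ∀ s, ext s = uVec r ∨ ext s = -uVec r)
    (hextinj : Function.Injective ext)
    (hcone : ∀ x : Fin (r + 1) → ℚ,
      ∃ c : ((i : Fin (r + 1)) × Fin (n i + 1)) ⊕ Fin m → ℚ,
        (∀ a, 0 ≤ c a) ∧ ∀ k, x k = ∑ a, c a * ((colOf r n l d m ext a k : ℤ) : ℚ))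
    (A : Fin (r + 1) → ((i : Fin (r + 1)) × Fin (n i + 1)) ⊕ Fin m)
    (hA : Function.Injective A)
    (hsomext : ∃ t s, A t = Sum.inr s)
    (hdet : (Matrix.of (fun k t : Fin (r + 1) => colOf r n l d m ext (A t) k)).det ≠ 0) :
    ∃ (s : Fin m) (i₁ : Fin (r + 1)) (jf : (i : Fin (r + 1)) → Fin (n i + 1)),
      (∀ t s', A t = Sum.inr s' → s' = s) ∧
      Set.range A =
        insert (Sum.inr s)
          ((fun i => (Sum.inl ⟨i, jf i⟩ :
              ((i : Fin (r + 1)) × Fin (n i + 1)) ⊕ Fin m)) '' {i | i ≠ i₁}) ∧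
      |(Matrix.of (fun k t : Fin (r + 1) => colOf r n l d m ext (A t) k)).det|
        = ∏ i ∈ Finset.univ.erase i₁, l i (jf i) := by
  obtain ⟨t₀, s, hs⟩ := hsomext
  obtain ⟨ε, hε, hεu⟩ : ∃ ε : ℤ, ε * ε = 1 ∧ ext s = ε • uVec r := by
    rcases hext s with h | h
    · exact ⟨1, by simp [h]⟩
    · exact ⟨-1, by simp [h]⟩
  have hu : ∀ k, uVec r k = ε * ext s k := fun k => by
    rw [hεu, Pi.smul_apply, smul_eq_mul, ← mul_assoc, hε, one_mul]
  have hinr : ∀ t s', A t = Sum.inr s' → t = t₀ := by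
    intro t s' ht
    by_contra hne
    obtain ⟨δ, hδ⟩ : ∃ δ : ℤ, ext s' = δ • uVec r := by
      rcases hext s' with h | h
      · exact ⟨1, by simp [h]⟩
      · exact ⟨-1, by simp [h]⟩
    refine hdet (det_eq_zero_of_col_combination _ hne hne (a := 1) (b := 0) (c := δ * ε)
      one_ne_zero fun k => ?_)
    simp only [Matrix.of_apply, ht, hs, colOf, Sum.elim_inr, hδ, Pi.smul_apply, smul_eq_mul]
    rw [hu k]
    ring
  have hblock : ∀ t t' i j j', A t = Sum.inl ⟨i, j⟩ → A t' = Sum.inl ⟨i, j'⟩ → t = t' := by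
    intro t t' i j j' ht ht'
    by_contra hne
    have hne₀ : t ≠ t₀ := by
      rintro rfl
      simp [hs] at ht
    refine hdet (det_eq_zero_of_col_combination _ hne hne₀ (a := l i j') (b := l i j)
      (c := (l i j' * d i j - l i j * d i j') * ε) (by have := hl i j'; omega) fun k => ?_)
    simp only [Matrix.of_apply, ht, ht', hs, colOf, Sum.elim_inl, Sum.elim_inr, colV]
    rw [hu k]
    ring
  obtain ⟨i₁, hi₁⟩ : ∃ i₁, ∀ t p, A t = Sum.inl p → p.1 ≠ i₁ := by
    let b : Fin (r + 1) → Fin (r + 1) := fun t => Sum.elim (fun p => p.1) (fun _ => 0) (A t)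
    have hcard : ((Finset.univ.erase t₀).image b).card < (Finset.univ : Finset (Fin (r + 1))).card :=
      Finset.card_image_le.trans_lt (Finset.card_erase_lt_of_mem (Finset.mem_univ t₀))
    obtain ⟨i₁, -, hi₁⟩ := Finset.exists_mem_notMem_of_card_lt_card hcard
    refine ⟨i₁, fun t p ht hp => hi₁ (Finset.mem_image.2 ⟨t, ?_, ?_⟩)⟩
    · refine Finset.mem_erase.2 ⟨?_, Finset.mem_univ t⟩
      rintro rfl
      simp [hs] at ht
    · simp [b, ht, hp]
  let b : Fin (r + 1) → Fin (r + 1) := fun t => Sum.elim (fun p => p.1) (fun _ => i₁) (A t)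
  have hbinl : ∀ t p, A t = Sum.inl p → b t = p.1 := fun t p ht => by simp [b, ht]
  have hbinr : b t₀ = i₁ := by simp [b, hs]
  have hb : Function.Injective b := by
    intro t t' h
    rcases ht : A t with ⟨i, j⟩ | s₁ <;> rcases ht' : A t' with ⟨i', j'⟩ | s₂
    · rw [hbinl t _ ht, hbinl t' _ ht'] at h
      obtain rfl : i = i' := h
      exact hblock t t' i j j' ht ht'
    · rw [hinr t' _ ht', hbinr, hbinl t _ ht] at h
      exact absurd h (hi₁ t _ ht)
    · rw [hinr t _ ht, hbinr, hbinl t' _ ht'] at h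
      exact absurd h.symm (hi₁ t' _ ht')
    · rw [hinr t _ ht, hinr t' _ ht']
  let σ : Equiv.Perm (Fin (r + 1)) := Equiv.ofBijective b (Finite.injective_iff_bijective.1 hb)
  have hσ : ∀ i, b (σ.symm i) = i := σ.apply_symm_apply
  have hσ₁ : σ.symm i₁ = t₀ := hb (by rw [hσ, hbinr])
  have hj : ∀ i, ∃ j, i ≠ i₁ → A (σ.symm i) = Sum.inl ⟨i, j⟩ := by
    intro i
    rcases ht : A (σ.symm i) with ⟨i', j⟩ | s'
    · obtain rfl : i = i' := by rw [← hσ i, hbinl _ _ ht]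
      exact ⟨j, fun _ => rfl⟩
    · refine ⟨0, fun hi => absurd ?_ hi⟩
      rw [← hσ i, hinr _ _ ht, hbinr]
  choose jf hjf using hj
  refine ⟨s, i₁, jf, fun t s' ht => ?_, ?_, ?_⟩
  · rw [hinr t s' ht, hs] at ht
    exact (Sum.inr_injective ht).symm
  · rw [← σ.symm.surjective.range_comp A]
    ext x
    simp only [Set.mem_range, Function.comp_apply, Set.mem_insert_iff, Set.mem_image,
      Set.mem_ofPred_eq]
    constructor
    · rintro ⟨i, rfl⟩
      by_cases hi : i = i₁
      · exact Or.inl (by rw [hi, hσ₁, hs])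
      · exact Or.inr ⟨i, hi, (hjf i hi).symm⟩
    · rintro (rfl | ⟨i, hi, rfl⟩)
      · exact ⟨i₁, by rw [hσ₁, hs]⟩
      · exact ⟨i, hjf i hi⟩
  · rw [← abs_det_of_blocks i₁ (fun i => l i (jf i)) (fun i => d i (jf i))
      (fun i => zero_le_one.trans (hl i _)) (ext s) (hext s),
      ← Matrix.abs_det_submatrix_equiv_equiv (Equiv.refl _) σ.symm]
    congr 2
    ext k i
    by_cases hi : i = i₁
    · simp [hi, hσ₁, hs, colOf]
    · simp [hi, hjf i hi, colOf, colV]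
end

section
/- Fix i₀ ∈ {0, …, r} and indices j_i ∈ {1, …, n_i} for all i = 0, …, r. Then there exist integers β_0, …, β_r such that μ(j_0, …, j_r) = β_{i₀} · μ(j_0, …, j_{i₀−1}, n_{i₀}, j_{i₀+1}, …, j_r) + Σ_{i₁ ≠ i₀} β_{i₁} · ν̂(i₀, j_{i₀}) · ∏_{i ∉ {i₀, i₁}} l_{i j_i}. -/
/-- Splitting off the block `i₀` from `muP`. -/
theorem muP_eq_add (r : ℕ) (n : Fin (r + 1) → ℕ)
    (l d : (i : Fin (r + 1)) → Fin (n i + 1) → ℤ) (i₀ : Fin (r + 1))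
    (j : (i : Fin (r + 1)) → Fin (n i + 1)) :
    muP r n l d j = d i₀ (j i₀) * ∏ i ∈ Finset.univ.erase i₀, l i (j i)
      + l i₀ (j i₀) * ∑ i₁ ∈ Finset.univ.erase i₀,
          d i₁ (j i₁) * ∏ i ∈ (Finset.univ.erase i₀).erase i₁, l i (j i) := by
  rw [muP, ← Finset.add_sum_erase _ _ (Finset.mem_univ i₀), Finset.mul_sum]
  congr 1
  refine Finset.sum_congr rfl fun i₁ h₁ => ?_
  have h : i₀ ∈ Finset.univ.erase i₁ := by
    simpa using (Finset.ne_of_mem_erase h₁).symm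
  rw [← Finset.mul_prod_erase _ _ h, Finset.erase_right_comm]
  ring

/-- Replacing the index of the block `i₀` only changes the coefficients belonging to `i₀`. -/
theorem muP_update (r : ℕ) (n : Fin (r + 1) → ℕ)
    (l d : (i : Fin (r + 1)) → Fin (n i + 1) → ℤ) (i₀ : Fin (r + 1))
    (j : (i : Fin (r + 1)) → Fin (n i + 1)) (k : Fin (n i₀ + 1)) :
    muP r n l d (Function.update j i₀ k) = d i₀ k * ∏ i ∈ Finset.univ.erase i₀, l i (j i)
      + l i₀ k * ∑ i₁ ∈ Finset.univ.erase i₀,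
          d i₁ (j i₁) * ∏ i ∈ (Finset.univ.erase i₀).erase i₁, l i (j i) := by
  have hne : ∀ i ∈ Finset.univ.erase i₀, Function.update j i₀ k i = j i := fun i hi =>
    Function.update_of_ne (Finset.ne_of_mem_erase hi) _ _
  rw [muP_eq_add r n l d i₀, Function.update_self]
  congr 2
  · exact Finset.prod_congr rfl fun i hi => by rw [hne i hi]
  · refine Finset.sum_congr rfl fun i₁ h₁ => ?_
    rw [hne i₁ h₁]
    congr 1
    exact Finset.prod_congr rfl fun i hi => by rw [hne i (Finset.mem_of_mem_erase hi)]

/-- fixing `i₀` and indices `j_i` in each block, there exist integers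
`β_0, …, β_r` with
`μ(j₀, …, j_r) = β_{i₀}·μ(j₀, …, n_{i₀}, …, j_r) + Σ_{i₁ ≠ i₀} β_{i₁}·ν̂(i₀, j_{i₀})·Π_{i ∉ {i₀,i₁}} l_{i j_i}`,
where `ν̂(i₀, j) = ν(i₀, j, n_{i₀})`. -/
theorem stmt6 (r : ℕ) (hr : 1 ≤ r) (n : Fin (r + 1) → ℕ)
    (l d : (i : Fin (r + 1)) → Fin (n i + 1) → ℤ)
    (hl : ∀ i j, 1 ≤ l i j)
    (hcop : ∀ i j, Int.gcd (l i j) (d i j) = 1)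
    (i₀ : Fin (r + 1)) (j : (i : Fin (r + 1)) → Fin (n i + 1)) :
    ∃ β : Fin (r + 1) → ℤ,
      muP r n l d j
        = β i₀ * muP r n l d (Function.update j i₀ (Fin.last (n i₀)))
          + ∑ i₁ ∈ Finset.univ.erase i₀,
              β i₁ * nuP r n l d i₀ (j i₀) (Fin.last (n i₀)) *
                ∏ i ∈ (Finset.univ.erase i₀).erase i₁, l i (j i) := by
  obtain ⟨x, y, hxy⟩ := Int.isCoprime_iff_gcd_eq_one.2 (hcop i₀ (Fin.last (n i₀)))
  have : Nontrivial (Fin (r + 1)) := Fin.nontrivial_iff_two_le.2 (by omega)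
  obtain ⟨k, hk⟩ := exists_ne i₀
  have hk' : k ∈ Finset.univ.erase i₀ := by simpa using hk
  refine ⟨fun i => if i = i₀ then x * l i₀ (j i₀) + y * d i₀ (j i₀)
    else y * d i (j i) - if i = k then x * l i (j i) else 0, ?_⟩
  set Q : Fin (r + 1) → ℤ := fun i₁ => ∏ i ∈ (Finset.univ.erase i₀).erase i₁, l i (j i) with hQ
  set S : ℤ := ∑ i₁ ∈ Finset.univ.erase i₀, d i₁ (j i₁) * Q i₁ with hS
  set ν : ℤ := nuP r n l d i₀ (j i₀) (Fin.last (n i₀)) with hν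
  have hsum : ∑ i₁ ∈ Finset.univ.erase i₀,
      (if i₁ = i₀ then x * l i₀ (j i₀) + y * d i₀ (j i₀)
        else y * d i₁ (j i₁) - if i₁ = k then x * l i₁ (j i₁) else 0) * ν * Q i₁
      = y * ν * S - x * ν * ∏ i ∈ Finset.univ.erase i₀, l i (j i) := by
    calc _ = ∑ i₁ ∈ Finset.univ.erase i₀, (y * ν * (d i₁ (j i₁) * Q i₁)
          - if i₁ = k then x * ν * (l i₁ (j i₁) * Q i₁) else 0) := by
            refine Finset.sum_congr rfl fun i₁ h₁ => ?_
            rw [if_neg (Finset.ne_of_mem_erase h₁)]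
            split_ifs <;> ring
      _ = _ := by
            rw [Finset.sum_sub_distrib, ← Finset.mul_sum, Finset.sum_ite_eq', if_pos hk',
              Finset.mul_prod_erase _ (fun i => l i (j i)) hk']
  rw [hsum]
  simp only [if_true]
  rw [muP_eq_add r n l d i₀, muP_update, hν, nuP, hS, hQ]
  linear_combination (-(d i₀ (j i₀) * ∏ i ∈ Finset.univ.erase i₀, l i (j i))
    - l i₀ (j i₀) * ∑ i₁ ∈ Finset.univ.erase i₀,
      d i₁ (j i₁) * ∏ i ∈ (Finset.univ.erase i₀).erase i₁, l i (j i)) * hxy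
end

section
/- Let P be a defining matrix of type (pe), (ep) or (pp). Then gcd(M(P)) = gcd(M'(P)), where M'(P) := { ∏_{i ≠ i₁} l_{i j_i} : 0 ≤ i₁ ≤ r, and 1 ≤ j_i ≤ n_i for all i ≠ i₁ }. -/
/-- The coordinates of `e_i` other than the `u`-coordinate. -/
lemma eVec_castSucc (r : ℕ) (i : Fin (r + 1)) (k : Fin r) :
    eVec r i k.castSucc = if i = 0 then -1 else if k.succ = i then 1 else 0 := by
  have hk : (k : ℕ) ≠ r := k.isLt.ne
  simp only [eVec, Fin.ext_iff, Fin.val_castSucc, Fin.val_succ, Fin.val_zero, hk, if_false]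

lemma uVec_castSucc (r : ℕ) (k : Fin r) : uVec r k.castSucc = 0 := by
  have hk : (k : ℕ) ≠ r := k.isLt.ne
  simp [uVec, hk]

lemma uVec_last (r : ℕ) : uVec r (Fin.last r) = 1 := by
  simp [uVec]

lemma colOf_inl_castSucc {r : ℕ} {n : Fin (r + 1) → ℕ}
    {l d : (i : Fin (r + 1)) → Fin (n i + 1) → ℤ} {m : ℕ} {ext : Fin m → Fin (r + 1) → ℤ}
    (p : (i : Fin (r + 1)) × Fin (n i + 1)) (k : Fin r) :
    colOf r n l d m ext (Sum.inl p) k.castSucc = l p.1 p.2 * eVec r p.1 k.castSucc := by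
  simp [colOf, colV, uVec_castSucc]

/-- Any `r` of the vectors `e_0, …, e_r` form a basis of `ℤ^r`. -/
lemma isUnit_det_eVec_succAbove (r : ℕ) (i₁ : Fin (r + 1)) :
    IsUnit (Matrix.of fun k t : Fin r => eVec r (i₁.succAbove t) k.castSucc).det := by
  rw [← Matrix.isUnit_iff_isUnit_det, ← Matrix.mulVec_surjective_iff_isUnit]
  intro y
  let Y : Fin (r + 1) → ℤ := Fin.cons 0 y
  refine ⟨fun t => Y (i₁.succAbove t) - Y i₁, ?_⟩
  ext k
  have key : ∑ i, (Y i - Y i₁) * eVec r i k.castSucc = y k := by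
    rw [Fin.sum_univ_succ]
    simp [eVec_castSucc, Y]
  rw [← key, Fin.sum_univ_succAbove _ i₁]
  simp [Matrix.mulVec, dotProduct, mul_comm]

/-- The gcd of the products `∏_{i ≠ i₁} l_{i j_i}` divides every product of `l`'s over columns
from `r` distinct blocks. -/
lemma gcd_dvd_prod_of_injective {r : ℕ} {n : Fin (r + 1) → ℕ}
    (l : (i : Fin (r + 1)) → Fin (n i + 1) → ℤ)
    (p : Fin r → (i : Fin (r + 1)) × Fin (n i + 1))
    (hp : Function.Injective fun t => (p t).1) :
    ((Finset.univ.gcd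
      (fun p : Fin (r + 1) × ((i : Fin (r + 1)) → Fin (n i + 1)) =>
        (∏ i ∈ Finset.univ.erase p.1, l i (p.2 i)).natAbs) : ℕ) : ℤ) ∣
      ∏ t, l (p t).1 (p t).2 := by
  classical
  have hq : ∃ q : (i : Fin (r + 1)) → Fin (n i + 1), ∀ t, q (p t).1 = (p t).2 := by
    refine ⟨fun i => if h : ∃ t, (p t).1 = i then h.choose_spec ▸ (p h.choose).2 else 0, ?_⟩
    intro t
    have h : ∃ s, (p s).1 = (p t).1 := ⟨t, rfl⟩
    have aux : ∀ s (hs : (p s).1 = (p t).1), (hs ▸ (p s).2 : Fin (n (p t).1 + 1)) = (p t).2 := by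
      intro s hs
      obtain rfl : s = t := hp hs
      rfl
    simp only [h, dif_pos]
    exact aux _ _
  obtain ⟨q, hq⟩ := hq
  obtain ⟨i₁, hi₁⟩ : ∃ i₁, Finset.univ.image (fun t => (p t).1) = Finset.univ.erase i₁ := by
    have hc : (Finset.univ.image (fun t => (p t).1))ᶜ.card = 1 := by
      rw [Finset.card_compl, Finset.card_image_of_injective _ hp]
      simp
    obtain ⟨i₁, h⟩ := Finset.card_eq_one.1 hc
    refine ⟨i₁, ?_⟩
    rw [← compl_compl (Finset.univ.image _), h]
    ext; simp
  have hprod : ∏ t, l (p t).1 (p t).2 = ∏ i ∈ Finset.univ.erase i₁, l i (q i) := by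
    rw [← hi₁, Finset.prod_image hp.injOn]
    simp [hq]
  rw [hprod, Int.natCast_dvd]
  exact Finset.gcd_dvd (f := fun p : Fin (r + 1) × ((i : Fin (r + 1)) → Fin (n i + 1)) =>
    (∏ i ∈ Finset.univ.erase p.1, l i (p.2 i)).natAbs) (Finset.mem_univ (i₁, q))

/-- Deleting the `u`-coordinate from `r` columns of a defining matrix gives a determinant
divisible by the gcd of the products `∏_{i ≠ i₁} l_{i j_i}`. -/
lemma gcd_dvd_det_castSucc {r : ℕ} {n : Fin (r + 1) → ℕ}
    (l d : (i : Fin (r + 1)) → Fin (n i + 1) → ℤ) {m : ℕ} {ext : Fin m → Fin (r + 1) → ℤ}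
    (hext : ∀ s, ext s = uVec r ∨ ext s = -uVec r)
    (B : Fin r → ((i : Fin (r + 1)) × Fin (n i + 1)) ⊕ Fin m) :
    ((Finset.univ.gcd
      (fun p : Fin (r + 1) × ((i : Fin (r + 1)) → Fin (n i + 1)) =>
        (∏ i ∈ Finset.univ.erase p.1, l i (p.2 i)).natAbs) : ℕ) : ℤ) ∣
      (Matrix.of fun k t : Fin r => colOf r n l d m ext (B t) k.castSucc).det := by
  by_cases hB : ∃ t s, B t = Sum.inr s
  · obtain ⟨t, s, hts⟩ := hB
    rw [Matrix.det_eq_zero_of_column_eq_zero t]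
    · exact dvd_zero _
    · intro k
      rcases hext s with h | h <;> simp [hts, colOf, h, uVec_castSucc]
  · have hp : ∀ t, ∃ p, B t = Sum.inl p := by
      intro t
      cases h : B t with
      | inl p => exact ⟨p, rfl⟩
      | inr s => exact absurd ⟨t, s, h⟩ hB
    choose p hp using hp
    have hdet : (Matrix.of fun k t : Fin r => colOf r n l d m ext (B t) k.castSucc).det =
        (∏ t, l (p t).1 (p t).2) *
          (Matrix.of fun k t : Fin r => eVec r (p t).1 k.castSucc).det := by
      rw [← Matrix.det_mul_row]
      simp only [hp, colOf_inl_castSucc, Matrix.of_apply]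
    rw [hdet]
    by_cases hinj : Function.Injective fun t => (p t).1
    · exact (gcd_dvd_prod_of_injective l p hinj).mul_right _
    · obtain ⟨a, b, hab, hne⟩ := Function.not_injective_iff.1 hinj
      rw [Matrix.det_zero_of_column_eq hne (fun k => by simp only [Matrix.of_apply]; rw [hab]),
        mul_zero]
      exact dvd_zero _

/-- The maximal minor formed by a column `±u` and one column from each block `i ≠ i₁` is, up to
sign, `∏_{i ≠ i₁} l_{i j_i}`. -/
lemma natAbs_det_cons_ext {r : ℕ} {n : Fin (r + 1) → ℕ}
    (l d : (i : Fin (r + 1)) → Fin (n i + 1) → ℤ) {m : ℕ} {ext : Fin m → Fin (r + 1) → ℤ}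
    (hext : ∀ s, ext s = uVec r ∨ ext s = -uVec r) (s : Fin m)
    (i₁ : Fin (r + 1)) (q : (i : Fin (r + 1)) → Fin (n i + 1)) :
    (Matrix.of fun k t : Fin (r + 1) => colOf r n l d m ext
      ((Fin.cons (Sum.inr s) fun t => Sum.inl ⟨i₁.succAbove t, q (i₁.succAbove t)⟩ :
        Fin (r + 1) → ((i : Fin (r + 1)) × Fin (n i + 1)) ⊕ Fin m) t) k).det.natAbs =
      (∏ i ∈ Finset.univ.erase i₁, l i (q i)).natAbs := by
  have hlast : (ext s (Fin.last r)).natAbs = 1 := by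
    rcases hext s with h | h <;> simp [h, uVec_last]
  have hcast : ∀ k : Fin r, ext s k.castSucc = 0 := by
    intro k
    rcases hext s with h | h <;> simp [h, uVec_castSucc]
  have hprod : ∏ i ∈ Finset.univ.erase i₁, l i (q i) =
      ∏ t, l (i₁.succAbove t) (q (i₁.succAbove t)) := by
    rw [← Finset.compl_singleton, ← Fin.image_succAbove_univ,
      Finset.prod_image Fin.succAbove_right_injective.injOn]
  have hminor : (Matrix.of fun k t : Fin r =>
      l (i₁.succAbove t) (q (i₁.succAbove t)) * eVec r (i₁.succAbove t) k.castSucc).det =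
        (∏ t, l (i₁.succAbove t) (q (i₁.succAbove t))) *
          (Matrix.of fun k t : Fin r => eVec r (i₁.succAbove t) k.castSucc).det := by
    rw [← Matrix.det_mul_row]
    simp only [Matrix.of_apply]
  rw [Matrix.det_succ_column_zero, Fin.sum_univ_castSucc, Finset.sum_eq_zero]
  · have hsub : (Matrix.of fun k t : Fin (r + 1) => colOf r n l d m ext
        ((Fin.cons (Sum.inr s) fun t => Sum.inl ⟨i₁.succAbove t, q (i₁.succAbove t)⟩ :
          Fin (r + 1) → ((i : Fin (r + 1)) × Fin (n i + 1)) ⊕ Fin m) t) k).submatrix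
          (Fin.last r).succAbove Fin.succ =
        Matrix.of fun k t : Fin r =>
          l (i₁.succAbove t) (q (i₁.succAbove t)) * eVec r (i₁.succAbove t) k.castSucc := by
      ext k t
      simp [colOf_inl_castSucc]
    rw [hsub, hminor, hprod]
    simp only [zero_add, Int.natAbs_mul, Int.natAbs_pow, Matrix.of_apply, Fin.cons_zero,
      Int.isUnit_iff_natAbs_eq.1 (isUnit_det_eVec_succAbove r i₁)]
    simp [colOf, hlast]
  · intro k _
    simp [colOf, hcast]

/-- for a defining matrix `P` of type (pe), (ep) or (pp),
`gcd(M(P)) = gcd(M'(P))`, where `M(P)` is the set of absolute values of maximal minors of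
`P` (realized as the gcd of `|det(P_A)|` over all choices `A` of `r+1` columns of `P`) and
`M'(P) = { Π_{i ≠ i₁} l_{i j_i} : 0 ≤ i₁ ≤ r, 1 ≤ j_i ≤ n_i }`. -/
theorem stmt8 (r : ℕ) (hr : 1 ≤ r) (n : Fin (r + 1) → ℕ)
    (l d : (i : Fin (r + 1)) → Fin (n i + 1) → ℤ)
    (hl : ∀ i j, 1 ≤ l i j)
    (hcop : ∀ i j, Int.gcd (l i j) (d i j) = 1)
    (hslope : ∀ (i : Fin (r + 1)) (j j' : Fin (n i + 1)), j < j' →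
      (d i j' : ℚ) / (l i j' : ℚ) < (d i j : ℚ) / (l i j : ℚ))
    (m : ℕ) (hm1 : 1 ≤ m) (hm2 : m ≤ 2)
    (ext : Fin m → Fin (r + 1) → ℤ)
    (hext : ∀ s, ext s = uVec r ∨ ext s = -uVec r)
    (hextinj : Function.Injective ext)
    (hcone : ∀ x : Fin (r + 1) → ℚ,
      ∃ c : ((i : Fin (r + 1)) × Fin (n i + 1)) ⊕ Fin m → ℚ,
        (∀ a, 0 ≤ c a) ∧ ∀ k, x k = ∑ a, c a * ((colOf r n l d m ext a k : ℤ) : ℚ)) :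
    Finset.univ.gcd
      (fun A : Fin (r + 1) → (((i : Fin (r + 1)) × Fin (n i + 1)) ⊕ Fin m) =>
        (Matrix.of (fun k t : Fin (r + 1) => colOf r n l d m ext (A t) k)).det.natAbs)
      =
    Finset.univ.gcd
      (fun p : Fin (r + 1) × ((i : Fin (r + 1)) → Fin (n i + 1)) =>
        (∏ i ∈ Finset.univ.erase p.1, l i (p.2 i)).natAbs) := by
  apply Nat.dvd_antisymm
  · refine Finset.dvd_gcd fun p _ => ?_
    rw [← natAbs_det_cons_ext l d hext ⟨0, hm1⟩ p.1 p.2]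
    exact Finset.gcd_dvd
      (f := fun A : Fin (r + 1) → (((i : Fin (r + 1)) × Fin (n i + 1)) ⊕ Fin m) =>
        (Matrix.of (fun k t : Fin (r + 1) => colOf r n l d m ext (A t) k)).det.natAbs)
      (Finset.mem_univ _)
  · refine Finset.dvd_gcd fun A _ => ?_
    rw [← Int.natCast_dvd, Matrix.det_succ_row _ (Fin.last r)]
    refine Finset.dvd_sum fun j _ => Dvd.dvd.mul_left ?_ _
    rw [Fin.succAbove_last]
    exact gcd_dvd_det_castSucc l d hext fun t => A (j.succAbove t)
end

section
/- Let s ≥ 1 and for each m = 1, …, s let l_m, d_m, λ_m, δ_m be integers with gcd(λ_m, δ_m) = 1, and set ν_m := l_m·δ_m − λ_m·d_m. For 0 ≤ t ≤ s define x_t := l_1 ⋯ l_t · λ_{t+1} ⋯ λ_s, and for 1 ≤ m ≤ s define y_m := l_1 ⋯ l_{m−1} · ν_m · λ_{m+1} ⋯ λ_s. Then gcd(x_0, y_1, …, y_s) divides x_s = l_1 ⋯ l_s. -/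
theorem dvd_mul_mul_of_isCoprime {R : Type*} [CommRing R] {g P Q l d a b : R}
    (hab : IsCoprime a b) (hx : g ∣ P * (a * Q)) (hy : g ∣ P * (l * b - a * d) * Q) :
    g ∣ P * l * Q := by
  obtain ⟨u, v, huv⟩ := hab
  have h : P * l * Q = (l * u + v * d) * (P * (a * Q)) + v * (P * (l * b - a * d) * Q) := by
    linear_combination -(P * l * Q) * huv
  rw [h]
  exact dvd_add (hx.mul_left _) (hy.mul_left _)

theorem dvd_prod_Icc_mul_prod_Icc {R : Type*} [CommRing R] {s : ℕ} {g : R} {l d lam δ : ℕ → R}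
    (hcop : ∀ m ∈ Finset.Icc 1 s, IsCoprime (lam m) (δ m))
    (hx : g ∣ ∏ m ∈ Finset.Icc 1 s, lam m)
    (hy : ∀ m ∈ Finset.Icc 1 s, g ∣ (∏ k ∈ Finset.Icc 1 (m - 1), l k) *
      (l m * δ m - lam m * d m) * ∏ k ∈ Finset.Icc (m + 1) s, lam k) {t : ℕ} (ht : t ≤ s) :
    g ∣ (∏ k ∈ Finset.Icc 1 t, l k) * ∏ k ∈ Finset.Icc (t + 1) s, lam k := by
  induction t with
  | zero => simpa using hx
  | succ t ih =>
    have hm : t + 1 ∈ Finset.Icc 1 s := Finset.mem_Icc.2 ⟨by lia, ht⟩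
    have h := ih (by lia)
    rw [← Finset.mul_prod_Ioc_eq_prod_Icc ht, ← Finset.Icc_add_one_left_eq_Ioc] at h
    rw [Finset.prod_Icc_succ_top (by lia)]
    exact dvd_mul_mul_of_isCoprime (hcop _ hm) h (hy _ hm)


/-- let `s ≥ 1` and for `m = 1, …, s` let `l_m, d_m, λ_m, δ_m` be integers
with `gcd(λ_m, δ_m) = 1`, and set `ν_m := l_m·δ_m − λ_m·d_m`.  With
`x_t := l_1 ⋯ l_t · λ_{t+1} ⋯ λ_s` and `y_m := l_1 ⋯ l_{m−1} · ν_m · λ_{m+1} ⋯ λ_s`,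
the gcd of `x_0, y_1, …, y_s` divides `x_s = l_1 ⋯ l_s`. -/
theorem stmt10 (s : ℕ) (hs : 1 ≤ s) (l d lam δ : ℕ → ℤ)
    (hcop : ∀ m ∈ Finset.Icc 1 s, Int.gcd (lam m) (δ m) = 1) :
    (↑(Nat.gcd (∏ m ∈ Finset.Icc 1 s, lam m).natAbs
        ((Finset.Icc 1 s).gcd fun m =>
          ((∏ k ∈ Finset.Icc 1 (m - 1), l k) * (l m * δ m - lam m * d m) *
            ∏ k ∈ Finset.Icc (m + 1) s, lam k).natAbs)) : ℤ)
      ∣ ∏ m ∈ Finset.Icc 1 s, l m := by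
  have h := dvd_prod_Icc_mul_prod_Icc (l := l) (d := d) (t := s)
    (fun m hm => Int.isCoprime_iff_gcd_eq_one.2 (hcop m hm))
    (Int.natCast_dvd.2 (Nat.gcd_dvd_left _ _))
    (fun m hm => Int.natCast_dvd.2 ((Nat.gcd_dvd_right _ _).trans
      (Finset.gcd_dvd (f := fun m => ((∏ k ∈ Finset.Icc 1 (m - 1), l k) *
        (l m * δ m - lam m * d m) * ∏ k ∈ Finset.Icc (m + 1) s, lam k).natAbs) hm))) le_rfl
  simpa using h
end

section
/- Assume r ≥ 2. For every k with 1 ≤ k ≤ r−1, one has gcd(M'_k ∪ M''_{k+1}) = gcd(M''_k). -/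
/-- `ν̂(i, j) = l_{ij}·d_{i n_i} − l_{i n_i}·d_{ij}`.  Block `i` has `n i + 1` indices,
its last index `Fin.last (n i)` playing the role of `n_i`. -/
def nuHat (r : ℕ) (n : Fin (r + 1) → ℕ) (l d : (i : Fin (r + 1)) → Fin (n i + 1) → ℤ)
    (i : Fin (r + 1)) (j : Fin (n i + 1)) : ℤ :=
  l i j * d i (Fin.last (n i)) - l i (Fin.last (n i)) * d i j

/-- The gcd of the set `M'_k`.  A valid subset `L ⊆ 𝓛` with `|L| = k` is encoded by the
set `I = π₁(L)` of its (pairwise distinct) first coordinates, with `I.card = k`, together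
with a choice `js i` of second coordinate for each `i ∈ I`, subject to `js i < n_i`
(i.e. `js i` is not the last index of block `i`); `i₁ ∉ I` is a further block index.
The corresponding element of `M'_k` is
`(Π_{(i,j) ∈ L} |ν̂(i,j)|) · (Π_{i ∉ I ∪ {i₁}} l_{i n_i})`. -/
def gcdMp (r : ℕ) (n : Fin (r + 1) → ℕ) (l d : (i : Fin (r + 1)) → Fin (n i + 1) → ℤ)
    (k : ℕ) : ℕ :=
  (Finset.univ.filter
    (fun p : Finset (Fin (r + 1)) × Fin (r + 1) × ((i : Fin (r + 1)) → Fin (n i + 1)) =>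
      p.1.card = k ∧ p.2.1 ∉ p.1 ∧ ∀ i ∈ p.1, ((p.2.2 i : ℕ) < n i))).gcd
    (fun p =>
      (∏ i ∈ p.1, (nuHat r n l d i (p.2.2 i)).natAbs) *
        ∏ i ∈ Finset.univ \ insert p.2.1 p.1, (l i (Fin.last (n i))).natAbs)

/-- The gcd of the set `M''_k`: as in `gcdMp`, but with an additional free choice
`jl i ∈ {1, …, n_i}` of index in each block `i ∉ I ∪ {i₁}`, the corresponding element
being `(Π_{(i,j) ∈ L} |ν̂(i,j)|) · (Π_{i ∉ I ∪ {i₁}} l_{i j_i})`. -/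
def gcdMpp (r : ℕ) (n : Fin (r + 1) → ℕ) (l d : (i : Fin (r + 1)) → Fin (n i + 1) → ℤ)
    (k : ℕ) : ℕ :=
  (Finset.univ.filter
    (fun p : (Finset (Fin (r + 1)) × Fin (r + 1) × ((i : Fin (r + 1)) → Fin (n i + 1))) ×
        ((i : Fin (r + 1)) → Fin (n i + 1)) =>
      p.1.1.card = k ∧ p.1.2.1 ∉ p.1.1 ∧ ∀ i ∈ p.1.1, ((p.1.2.2 i : ℕ) < n i))).gcd
    (fun p =>
      (∏ i ∈ p.1.1, (nuHat r n l d i (p.1.2.2 i)).natAbs) *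
        ∏ i ∈ Finset.univ \ insert p.1.2.1 p.1.1, (l i (p.2 i)).natAbs)

theorem gcd_last_nuHat_dvd (r : ℕ) (n : Fin (r + 1) → ℕ)
    (l d : (i : Fin (r + 1)) → Fin (n i + 1) → ℤ) (hcop : ∀ i j, Int.gcd (l i j) (d i j) = 1)
    (i : Fin (r + 1)) (j : Fin (n i + 1)) :
    Nat.gcd (l i (Fin.last (n i))).natAbs (nuHat r n l d i j).natAbs ∣ (l i j).natAbs := by
  rw [← Int.gcd_def, ← Int.natCast_dvd]
  have h₁ := Int.gcd_dvd_left (l i (Fin.last (n i))) (nuHat r n l d i j)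
  have h₂ := Int.gcd_dvd_right (l i (Fin.last (n i))) (nuHat r n l d i j)
  have h₃ := (dvd_sub_left (h₁.mul_right (d i j))).mp h₂
  exact ((Int.isCoprime_iff_gcd_eq_one.mpr (hcop i (Fin.last (n i)))).of_isCoprime_of_dvd_left
    h₁).dvd_of_dvd_mul_right h₃

theorem gcd_dvd_nuHat (r : ℕ) (n : Fin (r + 1) → ℕ)
    (l d : (i : Fin (r + 1)) → Fin (n i + 1) → ℤ) (i : Fin (r + 1)) (j : Fin (n i + 1)) :
    Nat.gcd (l i j).natAbs (l i (Fin.last (n i))).natAbs ∣ (nuHat r n l d i j).natAbs := by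
  rw [← Int.gcd_def, ← Int.natCast_dvd]
  exact dvd_sub ((Int.gcd_dvd_left _ _).mul_right _) ((Int.gcd_dvd_right _ _).mul_right _)

theorem gcdMp_dvd (r : ℕ) (n : Fin (r + 1) → ℕ)
    (l d : (i : Fin (r + 1)) → Fin (n i + 1) → ℤ) (I : Finset (Fin (r + 1)))
    (i₁ : Fin (r + 1)) (js : (i : Fin (r + 1)) → Fin (n i + 1)) (hi₁ : i₁ ∉ I)
    (hjs : ∀ i ∈ I, (js i : ℕ) < n i) :
    gcdMp r n l d I.card ∣ (∏ i ∈ I, (nuHat r n l d i (js i)).natAbs) *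
      ∏ i ∈ Finset.univ \ insert i₁ I, (l i (Fin.last (n i))).natAbs :=
  Finset.gcd_dvd (b := (I, i₁, js)) (Finset.mem_filter.mpr ⟨Finset.mem_univ _, rfl, hi₁, hjs⟩)

theorem gcdMpp_dvd (r : ℕ) (n : Fin (r + 1) → ℕ)
    (l d : (i : Fin (r + 1)) → Fin (n i + 1) → ℤ) (I : Finset (Fin (r + 1)))
    (i₁ : Fin (r + 1)) (js jl : (i : Fin (r + 1)) → Fin (n i + 1)) (hi₁ : i₁ ∉ I)
    (hjs : ∀ i ∈ I, (js i : ℕ) < n i) :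
    gcdMpp r n l d I.card ∣ (∏ i ∈ I, (nuHat r n l d i (js i)).natAbs) *
      ∏ i ∈ Finset.univ \ insert i₁ I, (l i (jl i)).natAbs :=
  Finset.gcd_dvd (b := ((I, i₁, js), jl))
    (Finset.mem_filter.mpr ⟨Finset.mem_univ _, rfl, hi₁, hjs⟩)

theorem gcdMpp_dvd_gcdMp (r : ℕ) (n : Fin (r + 1) → ℕ)
    (l d : (i : Fin (r + 1)) → Fin (n i + 1) → ℤ) (k : ℕ) :
    gcdMpp r n l d k ∣ gcdMp r n l d k := by
  refine Finset.dvd_gcd ?_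
  rintro ⟨I, i₁, js⟩ h
  obtain ⟨-, rfl, hi₁, hjs⟩ := Finset.mem_filter.mp h
  exact gcdMpp_dvd r n l d I i₁ js (fun i => Fin.last (n i)) hi₁ hjs

theorem gcdMpp_dvd_gcdMpp_succ (r : ℕ) (n : Fin (r + 1) → ℕ)
    (l d : (i : Fin (r + 1)) → Fin (n i + 1) → ℤ) (k : ℕ) :
    gcdMpp r n l d k ∣ gcdMpp r n l d (k + 1) := by
  refine Finset.dvd_gcd ?_
  rintro ⟨⟨J, i₁, js⟩, jl⟩ h
  obtain ⟨-, hcard, hi₁, hjs⟩ := Finset.mem_filter.mp h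
  dsimp only at hcard hi₁ hjs ⊢
  obtain ⟨s, I, hs, rfl, rfl⟩ := Finset.card_eq_succ.mp hcard
  have hsdiff : Finset.univ \ insert i₁ I =
      insert s (Finset.univ \ insert i₁ (insert s I)) := by grind
  have key (c : Fin (n s + 1)) : gcdMpp r n l d I.card ∣
      ((∏ i ∈ I, (nuHat r n l d i (js i)).natAbs) *
        ∏ i ∈ Finset.univ \ insert i₁ (insert s I), (l i (jl i)).natAbs) * (l s c).natAbs := by
    have h := gcdMpp_dvd r n l d I i₁ js (Function.update jl s c)
      (fun h => hi₁ (Finset.mem_insert_of_mem h)) (fun i hi => hjs i (Finset.mem_insert_of_mem hi))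
    rw [hsdiff, Finset.prod_insert (by simp), Function.update_self,
      Finset.prod_congr (s₁ := Finset.univ \ insert i₁ (insert s I)) rfl
        (g := fun i => (l i (jl i)).natAbs)
        (fun i hi => by rw [Function.update_of_ne (by rintro rfl; simp at hi)])] at h
    convert h using 1
    ring
  rw [Finset.prod_insert hs]
  have h := Nat.dvd_gcd (key (js s)) (key (Fin.last (n s)))
  rw [Nat.gcd_mul_left] at h
  convert h.trans (Nat.mul_dvd_mul_left _ (gcd_dvd_nuHat r n l d s (js s))) using 1
  ring

theorem gcd_gcdMp_gcdMpp_succ_dvd (r : ℕ) (n : Fin (r + 1) → ℕ)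
    (l d : (i : Fin (r + 1)) → Fin (n i + 1) → ℤ) (hcop : ∀ i j, Int.gcd (l i j) (d i j) = 1)
    (k : ℕ) :
    Nat.gcd (gcdMp r n l d k) (gcdMpp r n l d (k + 1)) ∣ gcdMpp r n l d k := by
  refine Finset.dvd_gcd ?_
  rintro ⟨⟨I, i₁, js⟩, jl⟩ h
  obtain ⟨-, hcard, hi₁, hjs⟩ := Finset.mem_filter.mp h
  dsimp only at hcard hi₁ hjs ⊢
  subst hcard
  suffices H : ∀ T : Finset (Fin (r + 1)),
      Nat.gcd (gcdMp r n l d I.card) (gcdMpp r n l d (I.card + 1)) ∣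
        (∏ i ∈ I, (nuHat r n l d i (js i)).natAbs) * ∏ i ∈ Finset.univ \ insert i₁ I,
          (l i (if i ∈ T then jl i else Fin.last (n i))).natAbs by
    simpa using H Finset.univ
  intro T
  induction T using Finset.induction_on with
  | empty =>
    simpa using (Nat.gcd_dvd_left _ _).trans (gcdMp_dvd r n l d I i₁ js hi₁ hjs)
  | insert t T ht ih =>
    have hcongr (C : Finset (Fin (r + 1))) (hC : t ∉ C) :
        ∏ i ∈ C, (l i (if i ∈ insert t T then jl i else Fin.last (n i))).natAbs =
          ∏ i ∈ C, (l i (if i ∈ T then jl i else Fin.last (n i))).natAbs :=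
      Finset.prod_congr rfl fun i hi => by
        have hit : i ≠ t := fun e => hC (e ▸ hi)
        simp [Finset.mem_insert, hit]
    by_cases htC : t ∈ Finset.univ \ insert i₁ I
    · have htI : t ∉ I := by grind
      have hti₁ : i₁ ∉ insert t I := by grind
      have hsdiff : Finset.univ \ insert i₁ I =
          insert t (Finset.univ \ insert i₁ (insert t I)) := by grind
      rw [hsdiff, Finset.prod_insert (by simp)] at ih ⊢
      rw [hcongr _ (by simp), if_pos (Finset.mem_insert_self t T)]
      rw [if_neg ht] at ih
      rcases eq_or_ne (jl t) (Fin.last (n t)) with hlast | hlast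
      · rwa [hlast]
      have h := gcdMpp_dvd r n l d (insert t I) i₁ (Function.update js t (jl t))
        (fun i => if i ∈ T then jl i else Fin.last (n i)) hti₁ (by
          intro i hi
          rcases eq_or_ne i t with rfl | hit
          · simpa using Fin.val_lt_last hlast
          · simpa [hit] using hjs i (Finset.mem_of_mem_insert_of_ne hi hit))
      rw [Finset.card_insert_of_notMem htI, Finset.prod_insert htI, Function.update_self,
        Finset.prod_congr rfl (g := fun i => (nuHat r n l d i (js i)).natAbs)
          (fun i hi => by rw [Function.update_of_ne (by rintro rfl; exact htI hi)])] at h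
      replace h := (Nat.gcd_dvd_right (gcdMp r n l d I.card) _).trans h
      rw [mul_left_comm, mul_comm] at ih
      rw [mul_assoc, mul_comm] at h
      have h' := Nat.dvd_gcd ih h
      rw [Nat.gcd_mul_left] at h'
      rw [mul_left_comm, mul_comm]
      exact h'.trans (Nat.mul_dvd_mul_left _ (gcd_last_nuHat_dvd r n l d hcop t (jl t)))
    · rwa [hcongr _ htC]

/-- for `r ≥ 2` and `1 ≤ k ≤ r − 1`,
`gcd(M'_k ∪ M''_{k+1}) = gcd(M''_k)`. -/
theorem stmt11 (r : ℕ) (hr : 2 ≤ r) (n : Fin (r + 1) → ℕ)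
    (l d : (i : Fin (r + 1)) → Fin (n i + 1) → ℤ)
    (hl : ∀ i j, 1 ≤ l i j)
    (hcop : ∀ i j, Int.gcd (l i j) (d i j) = 1)
    (k : ℕ) (hk1 : 1 ≤ k) (hk2 : k ≤ r - 1) :
    Nat.gcd (gcdMp r n l d k) (gcdMpp r n l d (k + 1)) = gcdMpp r n l d k := by
  exact Nat.dvd_antisymm (gcd_gcdMp_gcdMpp_succ_dvd r n l d hcop k)
    (Nat.dvd_gcd (gcdMpp_dvd_gcdMp r n l d k) (gcdMpp_dvd_gcdMpp_succ r n l d k))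
end

section
/- One has gcd(M'_1 ∪ M'_2 ∪ ⋯ ∪ M'_r) = gcd(M''_1). -/
/-- Divisibility of a product of gcds can be tested on all products of choices. -/
lemma dvd_prod_gcd_mul_iff {ι : Type*} [DecidableEq ι] {κ : ι → Type*} [∀ i, Nonempty (κ i)]
    (S : (i : ι) → Finset (κ i)) (f : (i : ι) → κ i → ℕ) (x : ℕ) (I : Finset ι) (c : ℕ) :
    x ∣ (∏ i ∈ I, (S i).gcd (f i)) * c ↔
      ∀ js : (i : ι) → κ i, (∀ i ∈ I, js i ∈ S i) → x ∣ (∏ i ∈ I, f i (js i)) * c := by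
  classical
  induction I using Finset.induction_on generalizing c with
  | empty =>
    simp only [Finset.prod_empty, Finset.notMem_empty, false_imp_iff, implies_true, true_imp_iff]
    exact ⟨fun h _ => h, fun h => h fun _ => Classical.arbitrary _⟩
  | insert a I ha ih =>
    have key : x ∣ (∏ i ∈ insert a I, (S i).gcd (f i)) * c ↔
        ∀ j ∈ S a, x ∣ (∏ i ∈ I, (S i).gcd (f i)) * (f a j * c) := by
      have hprod : (∏ i ∈ insert a I, (S i).gcd (f i)) * c =
          (S a).gcd fun j => f a j * ((∏ i ∈ I, (S i).gcd (f i)) * c) := by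
        rw [Finset.prod_insert ha, Finset.gcd_mul_right, normalize_eq, mul_assoc]
      rw [hprod, Finset.dvd_gcd_iff]
      simp only [mul_left_comm]
    rw [key]
    constructor
    · intro h js hjs
      rw [Finset.prod_insert ha, mul_assoc, mul_left_comm]
      exact (ih _).1 (h (js a) (hjs a (Finset.mem_insert_self a I))) js
        fun i hi => hjs i (Finset.mem_insert_of_mem hi)
    · intro h j hj
      refine (ih _).2 fun js hjs => ?_
      have hne : ∀ i ∈ I, Function.update js a j i = js i := fun i hi =>
        Function.update_of_ne (ne_of_mem_of_not_mem hi ha) _ _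
      have h' := h (Function.update js a j) fun i hi => by
        rcases Finset.mem_insert.1 hi with rfl | hi
        · simpa using hj
        · simpa only [hne i hi] using hjs i hi
      rw [Finset.prod_insert ha, Function.update_self,
        Finset.prod_congr rfl fun i hi => by rw [hne i hi]] at h'
      rwa [mul_left_comm, ← mul_assoc]

/-- The gcd of all `|ν̂(i, j)|` with `(i, j) ∈ 𝓛`, for a fixed block `i`. -/
def nuGcd (r : ℕ) (n : Fin (r + 1) → ℕ) (l d : (i : Fin (r + 1)) → Fin (n i + 1) → ℤ)
    (i : Fin (r + 1)) : ℕ :=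
  (Finset.univ.filter fun j : Fin (n i + 1) => (j : ℕ) < n i).gcd
    fun j => (nuHat r n l d i j).natAbs

lemma gcd_nuGcd_last (r : ℕ) (n : Fin (r + 1) → ℕ)
    (l d : (i : Fin (r + 1)) → Fin (n i + 1) → ℤ)
    (hcop : ∀ i j, Int.gcd (l i j) (d i j) = 1) (i : Fin (r + 1)) :
    Nat.gcd (nuGcd r n l d i) (l i (Fin.last (n i))).natAbs =
      Finset.univ.gcd fun j => (l i j).natAbs := by
  refine Nat.dvd_antisymm (Finset.dvd_gcd fun j _ => ?_)
    (Nat.dvd_gcd (Finset.dvd_gcd fun j _ => ?_) (Finset.gcd_dvd (Finset.mem_univ _)))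
  · rcases Nat.lt_or_ge (j : ℕ) (n i) with hj | hj
    · rw [← Int.natCast_dvd]
      set g := Nat.gcd (nuGcd r n l d i) (l i (Fin.last (n i))).natAbs
      have hL : (g : ℤ) ∣ l i (Fin.last (n i)) := Int.natCast_dvd.2 (Nat.gcd_dvd_right _ _)
      have hN : (g : ℤ) ∣ nuHat r n l d i j := Int.natCast_dvd.2 <|
        (Nat.gcd_dvd_left _ _).trans (Finset.gcd_dvd (by simpa using hj))
      have hprod : (g : ℤ) ∣ l i j * d i (Fin.last (n i)) := by
        have := hN.add (hL.mul_right (d i j))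
        simpa only [nuHat, sub_add_cancel] using this
      exact ((Int.isCoprime_iff_gcd_eq_one.2 (hcop i _)).of_isCoprime_of_dvd_left hL).dvd_of_dvd_mul_right
        hprod
    · obtain rfl : j = Fin.last (n i) := Fin.ext (by have := j.isLt; simp; omega)
      exact Nat.gcd_dvd_right _ _
  · have h : ∀ j, ((Finset.univ.gcd fun j => (l i j).natAbs : ℕ) : ℤ) ∣ l i j := fun j =>
      Int.natCast_dvd.2 (Finset.gcd_dvd (f := fun j => (l i j).natAbs) (Finset.mem_univ j))
    exact Int.natCast_dvd.1 (((h j).mul_right _).sub ((h _).mul_right _))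

lemma dvd_gcdMp_iff (r : ℕ) (n : Fin (r + 1) → ℕ)
    (l d : (i : Fin (r + 1)) → Fin (n i + 1) → ℤ) (k x : ℕ) :
    x ∣ gcdMp r n l d k ↔ ∀ (I : Finset (Fin (r + 1))) (i₁ : Fin (r + 1)), I.card = k → i₁ ∉ I →
      x ∣ (∏ i ∈ I, nuGcd r n l d i) *
        ∏ i ∈ Finset.univ \ insert i₁ I, (l i (Fin.last (n i))).natAbs := by
  simp only [nuGcd, dvd_prod_gcd_mul_iff, gcdMp, Finset.dvd_gcd_iff, Finset.mem_filter,
    Finset.mem_univ, true_and, Prod.forall, and_imp]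
  exact ⟨fun h I i₁ hk hi js hjs => h I i₁ js hk hi hjs,
    fun h I i₁ js hk hi hjs => h I i₁ hk hi js hjs⟩

lemma dvd_gcdMpp_iff (r : ℕ) (n : Fin (r + 1) → ℕ)
    (l d : (i : Fin (r + 1)) → Fin (n i + 1) → ℤ) (k x : ℕ) :
    x ∣ gcdMpp r n l d k ↔ ∀ (I : Finset (Fin (r + 1))) (i₁ : Fin (r + 1)), I.card = k → i₁ ∉ I →
      x ∣ (∏ i ∈ I, nuGcd r n l d i) *
        ∏ i ∈ Finset.univ \ insert i₁ I, Finset.univ.gcd fun j => (l i j).natAbs := by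
  have hswap : ∀ (I T : Finset (Fin (r + 1))),
      (x ∣ (∏ i ∈ I, nuGcd r n l d i) * ∏ i ∈ T, Finset.univ.gcd fun j => (l i j).natAbs) ↔
      ∀ js : (i : Fin (r + 1)) → Fin (n i + 1), (∀ i ∈ I, (js i : ℕ) < n i) →
        ∀ jl : (i : Fin (r + 1)) → Fin (n i + 1),
        x ∣ (∏ i ∈ I, (nuHat r n l d i (js i)).natAbs) * ∏ i ∈ T, (l i (jl i)).natAbs := by
    intro I T
    simp only [nuGcd, dvd_prod_gcd_mul_iff, Finset.mem_filter, Finset.mem_univ, true_and]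
    refine forall₂_congr fun js _ => ?_
    rw [mul_comm, dvd_prod_gcd_mul_iff]
    simp only [Finset.mem_univ, implies_true, true_imp_iff, mul_comm]
  simp only [hswap, gcdMpp, Finset.dvd_gcd_iff, Finset.mem_filter,
    Finset.mem_univ, true_and, Prod.forall, and_imp]
  exact ⟨fun h I i₁ hk hi js hjs jl => h I i₁ js jl hk hi hjs,
    fun h I i₁ js jl hk hi hjs => h I i₁ hk hi js hjs jl⟩

/-- Expanding a product of pairwise gcds over all ways of choosing one of the two factors. -/
lemma dvd_mul_prod_gcd_iff {ι : Type*} [DecidableEq ι] (a b : ι → ℕ) (x c : ℕ) (T : Finset ι) :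
    x ∣ c * ∏ i ∈ T, Nat.gcd (a i) (b i) ↔
      ∀ S ⊆ T, x ∣ c * ((∏ i ∈ S, a i) * ∏ i ∈ T \ S, b i) := by
  constructor
  · intro h S hS
    refine h.trans (mul_dvd_mul_left c ?_)
    rw [← Finset.prod_sdiff hS, mul_comm]
    exact mul_dvd_mul (Finset.prod_dvd_prod_of_dvd _ _ fun i _ => Nat.gcd_dvd_left _ _)
      (Finset.prod_dvd_prod_of_dvd _ _ fun i _ => Nat.gcd_dvd_right _ _)
  · intro h
    have hgcd : ∀ i, Nat.gcd (a i) (b i) =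
        (Finset.univ : Finset Bool).gcd fun t => if t then a i else b i := by
      intro i
      simp [Fintype.univ_bool, Finset.gcd_insert, gcd_eq_nat_gcd]
    simp only [hgcd]
    rw [mul_comm, dvd_prod_gcd_mul_iff (κ := fun _ => Bool) (fun _ => Finset.univ)
      (fun i t => if t then a i else b i)]
    intro js _
    rw [mul_comm, Finset.prod_ite, Finset.filter_not]
    exact h _ (Finset.filter_subset _ _)

/-- `gcd(M'_1 ∪ M'_2 ∪ ⋯ ∪ M'_r) = gcd(M''_1)`. -/
theorem stmt12 (r : ℕ) (hr : 1 ≤ r) (n : Fin (r + 1) → ℕ)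
    (l d : (i : Fin (r + 1)) → Fin (n i + 1) → ℤ)
    (hl : ∀ i j, 1 ≤ l i j)
    (hcop : ∀ i j, Int.gcd (l i j) (d i j) = 1) :
    (Finset.Icc 1 r).gcd (fun k => gcdMp r n l d k) = gcdMpp r n l d 1 := by
  rw [← Nat.dvd_left_iff_eq]
  intro x
  simp only [Finset.dvd_gcd_iff, dvd_gcdMp_iff, dvd_gcdMpp_iff, ← gcd_nuGcd_last r n l d hcop,
    dvd_mul_prod_gcd_iff]
  constructor
  · intro h I i₁ hI hi₁ S hS
    have hdisj : Disjoint I S := Finset.disjoint_left.2 fun i hi hiS => by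
      have := hS hiS
      simp [hi] at this
    have hi₁' : i₁ ∉ I ∪ S := fun hi => by
      rcases Finset.mem_union.1 hi with hi | hi
      · exact hi₁ hi
      · simpa using hS hi
    have hcard : (I ∪ S).card ∈ Finset.Icc 1 r := by
      have h1 := Finset.card_le_card (Finset.subset_union_left (s₁ := I) (s₂ := S))
      have h2 := Finset.card_lt_univ_of_notMem hi₁'
      rw [Fintype.card_fin] at h2
      rw [Finset.mem_Icc]
      omega
    have hx := h _ hcard (I ∪ S) i₁ rfl hi₁'
    rwa [Finset.prod_union hdisj, mul_assoc, ← Finset.insert_union, ← Finset.sup_eq_union,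
      ← sdiff_sdiff_left] at hx
  · intro h k hk I i₁ hI hi₁
    obtain ⟨i₀, hi₀⟩ : I.Nonempty := Finset.card_pos.1 (by rw [Finset.mem_Icc] at hk; omega)
    have hne : i₁ ≠ i₀ := fun e => hi₁ (e ▸ hi₀)
    have hx := h {i₀} i₁ (Finset.card_singleton _) (by simpa using hne) (I.erase i₀)
      fun i hi => by
        obtain ⟨hi0, hiI⟩ := Finset.mem_erase.1 hi
        have : i ≠ i₁ := fun e => hi₁ (e ▸ hiI)
        simp [hi0, this]
    rwa [Finset.prod_singleton, ← mul_assoc, Finset.mul_prod_erase _ _ hi₀, sdiff_sdiff_left,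
      Finset.sup_eq_union, Finset.insert_union, Finset.singleton_union,
      Finset.insert_erase hi₀] at hx
end

section
/- Let A be a set of n rows of P̂ with det(P̂_A) ≠ 0. Then |L(A)| = (r + 1) − |A ∩ {ẽ_1, …, ẽ_r, ũ}|; in particular 0 ≤ |L(A)| ≤ r + 1. -/
/-- The matrix `P̂` associated to a defining matrix of type (ee).  Rows are indexed by
`ê_{ij}, û_{ij}` (for `0 ≤ i ≤ r`, `1 ≤ j ≤ n_i − 1`, here `j : Fin (n i)`), by
`ẽ_1, …, ẽ_r` (here `Fin r`) and by `ũ` (here `Unit`); columns are indexed by `f̂_{ij}`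
(for `1 ≤ j ≤ n_i`, here `j : Fin (n i + 1)`, the last index playing the role of `n_i`).
For `j < n_i` the column `f̂_{ij}` has entry `l_{ij}` in row `ê_{ij}`, entry `d_{ij}` in
row `û_{ij}` and zeros elsewhere; the column `f̂_{i n_i}` has entries `−l_{i n_i}` in the
rows `ê_{ik}`, `−d_{i n_i}` in the rows `û_{ik}`, `d_{i n_i}` in row `ũ`, `l_{i n_i}` in
row `ẽ_i` if `i ≥ 1`, and `−l_{0 n_0}` in each row `ẽ_1, …, ẽ_r` if `i = 0`. -/
def PhatM (r : ℕ) (n : Fin (r + 1) → ℕ) (l d : (i : Fin (r + 1)) → Fin (n i + 1) → ℤ) :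
    Matrix ((((i : Fin (r + 1)) × Fin (n i)) ⊕ ((i : Fin (r + 1)) × Fin (n i))) ⊕
        (Fin r ⊕ Unit))
      ((i : Fin (r + 1)) × Fin (n i + 1)) ℤ :=
  Matrix.of fun row col =>
    match row with
    | Sum.inl (Sum.inl q) =>
        if (q.1 : ℕ) = (col.1 : ℕ) then
          (if (col.2 : ℕ) = n col.1 then -(l col.1 col.2)
           else if (col.2 : ℕ) = (q.2 : ℕ) then l col.1 col.2 else 0)
        else 0
    | Sum.inl (Sum.inr q) =>
        if (q.1 : ℕ) = (col.1 : ℕ) then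
          (if (col.2 : ℕ) = n col.1 then -(d col.1 col.2)
           else if (col.2 : ℕ) = (q.2 : ℕ) then d col.1 col.2 else 0)
        else 0
    | Sum.inr (Sum.inl t) =>
        if (col.2 : ℕ) = n col.1 then
          (if (col.1 : ℕ) = 0 then -(l col.1 col.2)
           else if (col.1 : ℕ) = (t : ℕ) + 1 then l col.1 col.2 else 0)
        else 0
    | Sum.inr (Sum.inr _) =>
        if (col.2 : ℕ) = n col.1 then d col.1 col.2 else 0

/-- For `j < n_i`, the column `f̂_{ij}` of `P̂` vanishes outside the rows `ê_{ij}` and `û_{ij}`. -/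
theorem PhatM_castSucc_eq_zero (r : ℕ) (n : Fin (r + 1) → ℕ)
    (l d : (i : Fin (r + 1)) → Fin (n i + 1) → ℤ) (q : (i : Fin (r + 1)) × Fin (n i))
    (x : (((i : Fin (r + 1)) × Fin (n i)) ⊕ ((i : Fin (r + 1)) × Fin (n i))) ⊕ (Fin r ⊕ Unit))
    (he : x ≠ Sum.inl (Sum.inl q)) (hu : x ≠ Sum.inl (Sum.inr q)) :
    PhatM r n l d x ⟨q.1, q.2.castSucc⟩ = 0 := by
  obtain ⟨i, j⟩ := q
  have hj : (j : ℕ) ≠ n i := j.isLt.ne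
  rcases x with (⟨i', j'⟩ | ⟨i', j'⟩) | t | t
  · by_cases h : i' = i
    · subst h
      have : (j : ℕ) ≠ j' := fun h => he (by rw [Fin.ext h])
      simp [PhatM, hj, this]
    · simp [PhatM, Fin.val_inj, h]
  · by_cases h : i' = i
    · subst h
      have : (j : ℕ) ≠ j' := fun h => hu (by rw [Fin.ext h])
      simp [PhatM, hj, this]
    · simp [PhatM, Fin.val_inj, h]
  · simp [PhatM, hj]
  · simp [PhatM, hj]

/-- if `A` is a set of `n` rows of `P̂` (encoded by an injective enumeration
`A` of the rows indexed by the `n` columns) with `det(P̂_A) ≠ 0`, then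
`|L(A)| = (r+1) − |A ∩ {ẽ_1, …, ẽ_r, ũ}|`; in particular `|L(A)| ≤ r + 1`.
Here `L(A) = {(i,j) : ê_{ij} ∈ A and û_{ij} ∈ A}`. -/
theorem stmt13 (r : ℕ) (hr : 1 ≤ r) (n : Fin (r + 1) → ℕ)
    (l d : (i : Fin (r + 1)) → Fin (n i + 1) → ℤ)
    (hl : ∀ i j, 1 ≤ l i j)
    (hcop : ∀ i j, Int.gcd (l i j) (d i j) = 1)
    (A : ((i : Fin (r + 1)) × Fin (n i + 1)) →
      ((((i : Fin (r + 1)) × Fin (n i)) ⊕ ((i : Fin (r + 1)) × Fin (n i))) ⊕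
        (Fin r ⊕ Unit)))
    (hA : Function.Injective A)
    (hdet : (Matrix.of (fun p q : (i : Fin (r + 1)) × Fin (n i + 1) =>
        PhatM r n l d (A p) q)).det ≠ 0) :
    (Finset.univ.filter (fun q : (i : Fin (r + 1)) × Fin (n i) =>
        (∃ t, A t = Sum.inl (Sum.inl q)) ∧ (∃ t, A t = Sum.inl (Sum.inr q)))).card
      = (r + 1) -
        (Finset.univ.filter (fun q : Fin r ⊕ Unit => ∃ t, A t = Sum.inr q)).card ∧
    (Finset.univ.filter (fun q : (i : Fin (r + 1)) × Fin (n i) =>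
        (∃ t, A t = Sum.inl (Sum.inl q)) ∧ (∃ t, A t = Sum.inl (Sum.inr q)))).card
      ≤ r + 1 := by
  set E := Finset.univ.filter (fun q : (i : Fin (r + 1)) × Fin (n i) =>
    ∃ t, A t = Sum.inl (Sum.inl q)) with hE
  set U := Finset.univ.filter (fun q : (i : Fin (r + 1)) × Fin (n i) =>
    ∃ t, A t = Sum.inl (Sum.inr q)) with hU
  set B := Finset.univ.filter (fun q : Fin r ⊕ Unit => ∃ t, A t = Sum.inr q) with hB
  rw [Finset.filter_and, ← hE, ← hU]
  have hcover : E ∪ U = Finset.univ := by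
    refine Finset.eq_univ_of_forall fun q => ?_
    by_contra hq
    simp only [hE, hU, Finset.mem_union, Finset.mem_filter, Finset.mem_univ, true_and,
      not_or, not_exists] at hq
    exact hdet (Matrix.det_eq_zero_of_column_eq_zero ⟨q.1, q.2.castSucc⟩ fun p =>
      PhatM_castSucc_eq_zero r n l d q (A p) (hq.1 p) (hq.2 p))
  have himage : Finset.univ.image A = (E.disjSum U).disjSum B := by
    ext x
    rcases x with (q | q) | q <;> simp [hE, hU, hB]
  have hcard := congrArg Finset.card himage
  rw [Finset.card_image_of_injective _ hA, Finset.card_disjSum, Finset.card_disjSum,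
    ← Finset.card_union_add_card_inter, hcover] at hcard
  simp only [Finset.card_univ, Fintype.card_sigma, Fintype.card_fin, Finset.sum_add_distrib,
    Finset.sum_const, smul_eq_mul, mul_one] at hcard
  omega
end

section
/- Let A be a set of n rows of P̂. If there exist an index i ∈ {0, …, r} and 1 ≤ j₀ < j₁ ≤ n_i − 1 with (i, j₀) ∈ L(A) and (i, j₁) ∈ L(A), then det(P̂_A) = 0. -/
/-- A square matrix over a domain with a linear relation between four rows, one of which is distinct
from the other three and has a nonzero coefficient, is singular. -/
theorem Matrix.det_eq_zero_of_four_rows {m R : Type*} [Fintype m] [DecidableEq m] [CommRing R]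
    [IsDomain R] (M : Matrix m m R) {p₁ p₂ p₃ p₄ : m} (h₁ : p₂ ≠ p₁) (h₃ : p₂ ≠ p₃) (h₄ : p₂ ≠ p₄)
    (c₁ c₂ c₃ c₄ : R) (hc : c₂ ≠ 0)
    (h : ∀ q, c₁ * M p₁ q + c₂ * M p₂ q + c₃ * M p₃ q + c₄ * M p₄ q = 0) : M.det = 0 := by
  rw [← Matrix.exists_vecMul_eq_zero_iff]
  refine ⟨Pi.single p₁ c₁ + Pi.single p₂ c₂ + Pi.single p₃ c₃ + Pi.single p₄ c₄, fun hv => hc ?_, ?_⟩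
  · simpa [h₁, h₃, h₄] using congrFun hv p₂
  · ext q
    simpa [Matrix.add_vecMul, Matrix.single_vecMul] using h q

/-- let `A` be a set of `n` rows of `P̂` (encoded by an injective
enumeration `A` of the rows indexed by the `n` columns).  If for some block `i` there are
`j₀ < j₁` with `(i, j₀) ∈ L(A)` and `(i, j₁) ∈ L(A)` (i.e. all four rows `ê_{i j₀}`,
`û_{i j₀}`, `ê_{i j₁}`, `û_{i j₁}` belong to `A`), then `det(P̂_A) = 0`. -/
theorem stmt14 (r : ℕ) (hr : 1 ≤ r) (n : Fin (r + 1) → ℕ)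
    (l d : (i : Fin (r + 1)) → Fin (n i + 1) → ℤ)
    (hl : ∀ i j, 1 ≤ l i j)
    (hcop : ∀ i j, Int.gcd (l i j) (d i j) = 1)
    (A : ((i : Fin (r + 1)) × Fin (n i + 1)) →
      ((((i : Fin (r + 1)) × Fin (n i)) ⊕ ((i : Fin (r + 1)) × Fin (n i))) ⊕
        (Fin r ⊕ Unit)))
    (hA : Function.Injective A)
    (i : Fin (r + 1)) (j₀ j₁ : Fin (n i)) (hj : j₀ < j₁)
    (h0e : ∃ t, A t = Sum.inl (Sum.inl ⟨i, j₀⟩))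
    (h0u : ∃ t, A t = Sum.inl (Sum.inr ⟨i, j₀⟩))
    (h1e : ∃ t, A t = Sum.inl (Sum.inl ⟨i, j₁⟩))
    (h1u : ∃ t, A t = Sum.inl (Sum.inr ⟨i, j₁⟩)) :
    (Matrix.of (fun p q : (i : Fin (r + 1)) × Fin (n i + 1) =>
        PhatM r n l d (A p) q)).det = 0 := by
  obtain ⟨s₀, hs₀⟩ := h0e
  obtain ⟨t₀, ht₀⟩ := h0u
  obtain ⟨s₁, hs₁⟩ := h1e
  obtain ⟨t₁, ht₁⟩ := h1u
  have hjv : (j₀ : ℕ) < j₁ := hj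
  have hts₀ : t₀ ≠ s₀ := by rintro rfl; simp [hs₀] at ht₀
  have hts : t₀ ≠ s₁ := by rintro rfl; simp [hs₁] at ht₀
  have htt : t₀ ≠ t₁ := by
    rintro rfl
    simp only [ht₁, Sum.inl.injEq, Sum.inr.injEq, Sigma.mk.injEq, heq_eq_eq, true_and] at ht₀
    exact hj.ne' ht₀
  have hts₁ : t₁ ≠ s₁ := by rintro rfl; simp [hs₁] at ht₁
  have hl₀ := hl i j₀.castSucc
  have hl₁ := hl i j₁.castSucc
  have hn₀ := j₀.isLt
  have hn₁ := j₁.isLt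
  set k := l i j₁.castSucc * d i (Fin.last _) - d i j₁.castSucc * l i (Fin.last _) with hk
  by_cases hk0 : k = 0
  · refine Matrix.det_eq_zero_of_four_rows _ hts₁ hts₁ hts₁ (d i j₁.castSucc)
      (-l i j₁.castSucc) 0 0 (by omega) ?_
    rintro ⟨i', j⟩
    simp only [Matrix.of_apply, hs₁, ht₁, PhatM]
    by_cases hi : i = i'
    · subst hi
      induction j using Fin.lastCases with
      | last => simp; linarith
      | cast j =>
        by_cases h₁ : j = j₁
        · subst h₁; simp [hn₁.ne]; ring
        · simp [j.isLt.ne, Fin.val_inj, h₁]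
    · simp [Fin.val_inj, hi]
  · refine Matrix.det_eq_zero_of_four_rows _ hts₀ hts htt (k * d i j₀.castSucc)
      (-(k * l i j₀.castSucc))
      (-((l i j₀.castSucc * d i (Fin.last _) - d i j₀.castSucc * l i (Fin.last _)) *
        d i j₁.castSucc))
      ((l i j₀.castSucc * d i (Fin.last _) - d i j₀.castSucc * l i (Fin.last _)) *
        l i j₁.castSucc) (neg_ne_zero.2 (mul_ne_zero hk0 (by omega))) ?_
    rintro ⟨i', j⟩
    simp only [Matrix.of_apply, hs₀, ht₀, hs₁, ht₁, PhatM]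
    by_cases hi : i = i'
    · subst hi
      induction j using Fin.lastCases with
      | last => simp [hk]; ring
      | cast j =>
        by_cases h₀ : j = j₀
        · subst h₀; simp [hn₀.ne, hjv.ne]; ring
        · by_cases h₁ : j = j₁
          · subst h₁; simp [hn₁.ne, hjv.ne']; ring
          · simp [j.isLt.ne, Fin.val_inj, h₀, h₁]
    · simp [Fin.val_inj, hi]
end

section
/- Let P be a defining matrix of type (ee) and let P̂ be the associated (2n − r − 1) × n matrix. Then the greatest common divisor of the set M(P̂) of all maximal (n × n) minors of P̂ equals the greatest common divisor of the set M(P) of all maximal ((r+1) × (r+1)) minors of P: gcd(M(P̂)) = gcd(M(P)). -/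
open Module Submodule in
/-- An integer dividing the values of an alternating map on all tuples from a family divides its
values on all tuples from the span of that family. -/
theorem AlternatingMap.dvd_of_mem_span_range {ι κ M : Type*} [Fintype ι] [Fintype κ]
    [DecidableEq κ] [AddCommGroup M] (f : M [⋀^κ]→ₗ[ℤ] ℤ) (v : ι → M) {c : ℤ}
    (hc : ∀ A : κ → ι, c ∣ f (fun k => v (A k))) (w : κ → M)
    (hw : ∀ k, w k ∈ span ℤ (Set.range v)) : c ∣ f w := by
  choose a ha using fun k => (mem_span_range_iff_exists_fun ℤ).1 (hw k)
  obtain rfl : w = fun k => ∑ i, a k i • v i := funext fun k => (ha k).symm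
  change c ∣ f.toMultilinearMap _
  rw [MultilinearMap.map_sum]
  refine Finset.dvd_sum fun A _ => ?_
  rw [MultilinearMap.map_smul_univ]
  exact Dvd.dvd.mul_left (hc A) _

open Module Submodule in
/-- The index of a submodule of a finite free `ℤ`-module divides the determinant of every tuple
of its elements (with index `0` for an infinite quotient). -/
theorem Submodule.card_quotient_dvd_natAbs_det {κ M : Type*} [Fintype κ] [DecidableEq κ]
    [AddCommGroup M] (e : Basis κ ℤ M) (N : Submodule ℤ M) (w : κ → N) :
    Nat.card (M ⧸ N) ∣ (e.det (fun k => (w k : M))).natAbs := by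
  have := Module.Free.of_basis e
  have := Module.Finite.of_basis e
  by_cases h : finrank ℤ N = finrank ℤ M
  · let b : Basis κ ℤ N :=
      Module.finBasisOfFinrankEq ℤ N (h.trans (finrank_eq_card_basis e)) |>.reindex
        (Fintype.equivFin κ).symm
    have key := congrArg (fun f => f w) ((e.det.compLinearMap N.subtype).eq_smul_basis_det b)
    change e.det (fun k => (w k : M)) = e.det ((↑) ∘ b) * b.det w at key
    rw [key, Int.natAbs_mul, natAbs_det_basis_change e N b]
    exact dvd_mul_right _ _
  · suffices e.det (fun k => (w k : M)) = 0 by simp [this]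
    by_contra hne
    have hli : LinearIndependent ℤ (fun k => (w k : M)) := by
      by_contra hli
      exact hne (e.det.map_linearDependent _ hli)
    have hli' : LinearIndependent ℤ w := LinearIndependent.of_comp N.subtype hli
    refine h (le_antisymm (finrank_le N) ?_)
    rw [finrank_eq_card_basis e]
    exact hli'.fintype_card_le_finrank

open Module Submodule in
/-- The gcd of the maximal minors of a finite family of vectors in a finite free `ℤ`-module is the
index of its span (read as `0` for an infinite quotient). -/
theorem Module.Basis.gcd_natAbs_det_eq_card_quotient {ι κ M : Type*} [Fintype ι] [Fintype κ]
    [DecidableEq κ] [AddCommGroup M] (e : Basis κ ℤ M) (v : ι → M) :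
    Finset.univ.gcd (fun A : κ → ι => (e.det (fun k => v (A k))).natAbs) =
      Nat.card (M ⧸ span ℤ (Set.range v)) := by
  have := Module.Free.of_basis e
  have := Module.Finite.of_basis e
  refine Nat.dvd_antisymm ?_ (Finset.dvd_gcd fun A _ =>
    card_quotient_dvd_natAbs_det e (span ℤ (Set.range v))
      fun k => ⟨v (A k), subset_span ⟨A k, rfl⟩⟩)
  by_cases h : finrank ℤ (span ℤ (Set.range v)) = finrank ℤ M
  · let b : Basis κ ℤ (span ℤ (Set.range v)) :=
      Module.finBasisOfFinrankEq ℤ _ (h.trans (finrank_eq_card_basis e)) |>.reindex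
        (Fintype.equivFin κ).symm
    rw [← natAbs_det_basis_change e _ b, ← Int.natCast_dvd]
    refine e.det.dvd_of_mem_span_range v (fun A => ?_) _ fun k => (b k).2
    rw [Int.natCast_dvd]
    exact Finset.gcd_dvd (Finset.mem_univ A)
  · have : Infinite (M ⧸ span ℤ (Set.range v)) := by
      rwa [← not_finite_iff_infinite, finiteQuotient_iff]
    simp

theorem eVec_succ_s15 (r : ℕ) (t : Fin r) : eVec r t.succ = Pi.single t.castSucc 1 := by
  ext k
  simp [eVec, Pi.single_apply, Fin.ext_iff]

section PhatRows

variable (r : ℕ) (n : Fin (r + 1) → ℕ) (l d : (i : Fin (r + 1)) → Fin (n i + 1) → ℤ)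

theorem PhatM_row_eHat (i : Fin (r + 1)) (j : Fin (n i)) :
    PhatM r n l d (Sum.inl (Sum.inl ⟨i, j⟩)) =
      l i j.castSucc • Pi.single ⟨i, j.castSucc⟩ 1
        - l i (Fin.last _) • Pi.single ⟨i, Fin.last _⟩ 1 := by
  ext ⟨i', j'⟩
  by_cases h : i' = i
  · subst h
    induction j' using Fin.lastCases with
    | last => simp [PhatM]
    | cast k =>
      by_cases hk : k = j
      · subst hk
        simp [PhatM, k.is_lt.ne]
      · have hk' : (k : ℕ) ≠ j := fun h => hk (Fin.ext h)
        simp [PhatM, k.is_lt.ne, hk, hk']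
  · have h' : (i : ℕ) ≠ i' := fun e => h (Fin.ext e.symm)
    simp [PhatM, h, h']

theorem PhatM_row_uHat (i : Fin (r + 1)) (j : Fin (n i)) :
    PhatM r n l d (Sum.inl (Sum.inr ⟨i, j⟩)) =
      d i j.castSucc • Pi.single ⟨i, j.castSucc⟩ 1
        - d i (Fin.last _) • Pi.single ⟨i, Fin.last _⟩ 1 :=
  PhatM_row_eHat r n d l i j

theorem PhatM_row_eTilde (t : Fin r) :
    PhatM r n l d (Sum.inr (Sum.inl t)) =
      l t.succ (Fin.last _) • Pi.single ⟨t.succ, Fin.last _⟩ 1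
        - l 0 (Fin.last _) • Pi.single ⟨0, Fin.last _⟩ 1 := by
  ext ⟨i, j⟩
  induction j using Fin.lastCases with
  | last =>
    induction i using Fin.cases with
    | zero => simp [PhatM, (Fin.succ_ne_zero t).symm]
    | succ s =>
      by_cases h : s = t
      · subst h
        simp [PhatM]
      · have h' : (s : ℕ) ≠ t := fun e => h (Fin.ext e)
        simp [PhatM, h, h']
  | cast k =>
    have aux : ∀ i', (⟨i, k.castSucc⟩ : (i : Fin (r + 1)) × Fin (n i + 1)) ≠
        ⟨i', Fin.last _⟩ := by
      rintro i' h
      obtain ⟨rfl, h⟩ := Sigma.mk.inj_iff.1 h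
      exact Fin.castSucc_ne_last k (eq_of_heq h)
    simp [PhatM, k.is_lt.ne, aux]

theorem PhatM_row_uTilde (x : Unit) :
    PhatM r n l d (Sum.inr (Sum.inr x)) =
      ∑ i, d i (Fin.last _) • Pi.single ⟨i, Fin.last _⟩ 1 := by
  ext ⟨i, j⟩
  rw [Finset.sum_apply, Finset.sum_eq_single i]
  · by_cases h : j = Fin.last _
    · subst h
      simp [PhatM]
    · have h' : (j : ℕ) ≠ n i := fun e => h (Fin.ext e)
      simp [PhatM, h, h']
  · intro i' _ h
    simp [h.symm]
  · simp

/-- The rows of `P̂` and the columns of `P` have isomorphic cokernels. -/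
theorem nonempty_quotient_PhatM_equiv_quotient_colV
    (hcop : ∀ i j, Int.gcd (l i j) (d i j) = 1) :
    Nonempty (((((i : Fin (r + 1)) × Fin (n i + 1)) → ℤ) ⧸
        Submodule.span ℤ (Set.range (PhatM r n l d))) ≃ₗ[ℤ]
      ((Fin (r + 1) → ℤ) ⧸ Submodule.span ℤ
        (Set.range fun a : (i : Fin (r + 1)) × Fin (n i + 1) => colV r n l d a.1 a.2))) := by
  choose α β hαβ using fun i j => Int.isCoprime_iff_gcd_eq_one.2 (hcop i j)
  set N₁ := Submodule.span ℤ (Set.range (PhatM r n l d)) with hN₁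
  set N₂ := Submodule.span ℤ
    (Set.range fun a : (i : Fin (r + 1)) × Fin (n i + 1) => colV r n l d a.1 a.2) with hN₂
  let E : Fin (r + 1) → (Fin (r + 1) → ℤ) ⧸ N₂ := fun i => N₂.mkQ (eVec r i)
  let U : (Fin (r + 1) → ℤ) ⧸ N₂ := N₂.mkQ (uVec r)
  have hE : ∑ i, E i = 0 := by
    simp only [E, ← map_sum, sum_eVec, map_zero]
  have hEU : ∀ i j, l i j • E i + d i j • U = 0 := fun i j => by
    simp only [E, U, ← map_smul, ← map_add]
    exact (Submodule.Quotient.mk_eq_zero _).2 (Submodule.subset_span ⟨⟨i, j⟩, rfl⟩)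
  let F : (i : Fin (r + 1)) → Fin (n i + 1) → (((i : Fin (r + 1)) × Fin (n i + 1)) → ℤ) ⧸ N₁ :=
    fun i j => N₁.mkQ (Pi.single ⟨i, j⟩ 1)
  have hrow : ∀ q, N₁.mkQ (PhatM r n l d q) = 0 := fun q =>
    (Submodule.Quotient.mk_eq_zero _).2 (Submodule.subset_span ⟨q, rfl⟩)
  have hFl : ∀ i j, l i j • F i j = l 0 (Fin.last _) • F 0 (Fin.last _) := by
    have hlast : ∀ i, l i (Fin.last _) • F i (Fin.last _) =
        l 0 (Fin.last _) • F 0 (Fin.last _) := by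
      intro i
      induction i using Fin.cases with
      | zero => rfl
      | succ t =>
        have := hrow (Sum.inr (Sum.inl t))
        rw [PhatM_row_eTilde, map_sub, map_smul, map_smul, sub_eq_zero] at this
        exact this
    intro i j
    induction j using Fin.lastCases with
    | last => exact hlast i
    | cast j =>
      have := hrow (Sum.inl (Sum.inl ⟨i, j⟩))
      rw [PhatM_row_eHat, map_sub, map_smul, map_smul, sub_eq_zero] at this
      exact this.trans (hlast i)
  have hFd : ∀ i j, d i j • F i j = d i (Fin.last _) • F i (Fin.last _) := by
    intro i j
    induction j using Fin.lastCases with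
    | last => rfl
    | cast j =>
      have := hrow (Sum.inl (Sum.inr ⟨i, j⟩))
      rw [PhatM_row_uHat, map_sub, map_smul, map_smul, sub_eq_zero] at this
      exact this
  have hFsum : ∑ i, d i (Fin.last _) • F i (Fin.last _) = 0 := by
    have := hrow (Sum.inr (Sum.inr ()))
    rw [PhatM_row_uTilde, map_sum] at this
    simpa only [map_smul] using this
  let G : (i : Fin (r + 1)) → Fin (n i + 1) → (Fin (r + 1) → ℤ) ⧸ N₂ :=
    fun i j => β i j • E i - α i j • U
  have hGl : ∀ i j, l i j • G i j = -U := fun i j => by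
    linear_combination (norm := module) β i j • hEU i j - hαβ i j • U
  have hGd : ∀ i j, d i j • G i j = E i := fun i j => by
    linear_combination (norm := module) (-α i j) • hEU i j + hαβ i j • E i
  let Ψ : (((i : Fin (r + 1)) × Fin (n i + 1)) → ℤ) →ₗ[ℤ] (Fin (r + 1) → ℤ) ⧸ N₂ :=
    Fintype.linearCombination ℤ fun s => G s.1 s.2
  have hΨ : ∀ i j, Ψ (Pi.single ⟨i, j⟩ 1) = G i j := fun i j => by
    simp [Ψ, Fintype.linearCombination_apply_single]
  let Φ : (Fin (r + 1) → ℤ) →ₗ[ℤ] (((i : Fin (r + 1)) × Fin (n i + 1)) → ℤ) ⧸ N₁ :=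
    Fintype.linearCombination ℤ (Fin.lastCases (-(l 0 (Fin.last _) • F 0 (Fin.last _)))
      fun t => d t.succ (Fin.last _) • F t.succ (Fin.last _))
  have hΦu : Φ (uVec r) = -(l 0 (Fin.last _) • F 0 (Fin.last _)) := by
    simp [Φ, uVec_eq_single, Fintype.linearCombination_apply_single]
  have hΦsucc : ∀ t : Fin r, Φ (eVec r t.succ) = d t.succ (Fin.last _) • F t.succ (Fin.last _) :=
    fun t => by simp [Φ, eVec_succ_s15, Fintype.linearCombination_apply_single]
  have hΦe : ∀ i, Φ (eVec r i) = d i (Fin.last _) • F i (Fin.last _) := by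
    intro i
    induction i using Fin.cases with
    | succ t => exact hΦsucc t
    | zero =>
      have h := congrArg Φ (sum_eVec r)
      rw [map_sum, map_zero, ← hFsum, Fin.sum_univ_succ, Fin.sum_univ_succ] at h
      simpa only [hΦsucc, add_left_inj] using h
  have hΨN : N₁ ≤ LinearMap.ker Ψ := by
    rw [hN₁, Submodule.span_le]
    rintro _ ⟨(⟨i, j⟩ | ⟨i, j⟩) | t | x, rfl⟩ <;> rw [SetLike.mem_coe, LinearMap.mem_ker]
    · simp only [PhatM_row_eHat, map_sub, map_smul, hΨ, hGl, sub_self]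
    · simp only [PhatM_row_uHat, map_sub, map_smul, hΨ, hGd, sub_self]
    · simp only [PhatM_row_eTilde, map_sub, map_smul, hΨ, hGl, sub_self]
    · simp only [PhatM_row_uTilde, map_sum, map_smul, hΨ, hGd, hE]
  have hΦN : N₂ ≤ LinearMap.ker Φ := by
    rw [hN₂, Submodule.span_le]
    rintro _ ⟨⟨i, j⟩, rfl⟩
    rw [SetLike.mem_coe, LinearMap.mem_ker]
    have : colV r n l d i j = l i j • eVec r i + d i j • uVec r := rfl
    simp only [this, map_add, map_smul, hΦe, hΦu]
    rw [← hFl i j, ← hFd i j, smul_neg, smul_smul, smul_smul, mul_comm, add_neg_cancel]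
  refine ⟨LinearEquiv.ofLinearMap (N₁.liftQ Ψ hΨN) (N₂.liftQ Φ hΦN) ?_ ?_⟩
  · refine Submodule.linearMap_qext _ (LinearMap.pi_ext' fun k => LinearMap.ext_ring ?_)
    change N₁.liftQ Ψ hΨN (Φ (Pi.single k 1)) = N₂.mkQ (Pi.single k 1)
    have hF : ∀ i j, N₁.liftQ Ψ hΨN (F i j) = G i j := fun i j => hΨ i j
    induction k using Fin.lastCases with
    | last => rw [← uVec_eq_single, hΦu, map_neg, map_smul, hF, hGl, neg_neg]
    | cast t => rw [← eVec_succ_s15, hΦe, map_smul, hF, hGd]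
  · refine Submodule.linearMap_qext _ (LinearMap.pi_ext' fun k => LinearMap.ext_ring ?_)
    obtain ⟨i, j⟩ := k
    change N₂.liftQ Φ hΦN (Ψ (Pi.single ⟨i, j⟩ 1)) = F i j
    have hE' : N₂.liftQ Φ hΦN (E i) = d i j • F i j := (hΦe i).trans (hFd i j).symm
    have hU' : N₂.liftQ Φ hΦN U = -(l i j • F i j) := hΦu.trans (by rw [hFl i j])
    rw [hΨ]
    simp only [G, map_sub, map_smul, hE', hU']
    linear_combination (norm := module) hαβ i j • F i j

end PhatRows

/-- for a defining matrix `P` of type (ee), the gcd of the maximal `n×n`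
minors of `P̂` equals the gcd of the maximal `(r+1)×(r+1)` minors of `P`.  Both gcds are
realized as gcds of `|det|` over all (enumerations of) choices of `n` rows of `P̂`,
respectively `r+1` columns of `P`. -/
theorem stmt15 (r : ℕ) (hr : 1 ≤ r) (n : Fin (r + 1) → ℕ)
    (l d : (i : Fin (r + 1)) → Fin (n i + 1) → ℤ)
    (hl : ∀ i j, 1 ≤ l i j)
    (hcop : ∀ i j, Int.gcd (l i j) (d i j) = 1)
    (hslope : ∀ (i : Fin (r + 1)) (j j' : Fin (n i + 1)), j < j' →
      (d i j' : ℚ) / (l i j' : ℚ) < (d i j : ℚ) / (l i j : ℚ))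
    (hcone : ∀ x : Fin (r + 1) → ℚ,
      ∃ c : ((i : Fin (r + 1)) × Fin (n i + 1)) → ℚ,
        (∀ a, 0 ≤ c a) ∧ ∀ k, x k = ∑ a, c a * ((colV r n l d a.1 a.2 k : ℤ) : ℚ)) :
    Finset.univ.gcd
      (fun A : ((i : Fin (r + 1)) × Fin (n i + 1)) →
          ((((i : Fin (r + 1)) × Fin (n i)) ⊕ ((i : Fin (r + 1)) × Fin (n i))) ⊕
            (Fin r ⊕ Unit)) =>
        (Matrix.of (fun p q : (i : Fin (r + 1)) × Fin (n i + 1) =>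
          PhatM r n l d (A p) q)).det.natAbs)
      =
    Finset.univ.gcd
      (fun B : Fin (r + 1) → ((i : Fin (r + 1)) × Fin (n i + 1)) =>
        (Matrix.of (fun k t : Fin (r + 1) =>
          colV r n l d (B t).1 (B t).2 k)).det.natAbs) := by
  classical
  have h₁ := (Pi.basisFun ℤ ((i : Fin (r + 1)) × Fin (n i + 1))).gcd_natAbs_det_eq_card_quotient
    (PhatM r n l d)
  have h₂ := (Pi.basisFun ℤ (Fin (r + 1))).gcd_natAbs_det_eq_card_quotient
    fun a : (i : Fin (r + 1)) × Fin (n i + 1) => colV r n l d a.1 a.2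
  obtain ⟨φ⟩ := nonempty_quotient_PhatM_equiv_quotient_colV r n l d hcop
  rw [← Nat.card_congr φ.toEquiv, ← h₁] at h₂
  refine Eq.trans ?_ (h₂.symm.trans ?_)
  · refine Finset.gcd_congr rfl fun A _ => ?_
    rw [Pi.basisFun_det_apply]
  · refine Finset.gcd_congr rfl fun B _ => ?_
    rw [Pi.basisFun_det_apply, ← Matrix.det_transpose]
    rfl
end

section
/- Let P = [v₀ v₁ v₂] be a 2×3 integer matrix whose columns are primitive and generate ℚ² as a convex cone. Set m₀ := |det[v₁ v₂]|, m₁ := |det[v₀ v₂]|, m₂ := |det[v₀ v₁]|, n := gcd(m₀, m₁, m₂), and w_i := m_i / n. Then w₀, w₁, w₂ are pairwise coprime positive integers, and there exist an integer x with 0 ≤ x < n·w₂ and gcd(x, n·w₂) = 1 and a matrix A ∈ GL₂(ℤ) such that w₂ divides w₀ + x·w₁ and A·P = [[1, x, −(w₀ + x·w₁)/w₂], [0, n·w₂, −n·w₁]]. -/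
/-- If the integer vectors `a`, `b`, `c` generate `ℚ²` as a convex cone, then `det [a, b]` is a
nonnegative rational multiple of `det [b, c]`. -/
lemma exists_pos_mul_det_eq_nonneg_mul_det {a₀ a₁ b₀ b₁ c₀ c₁ : ℤ}
    (h : ∀ x y : ℚ, ∃ r s t : ℚ, 0 ≤ r ∧ 0 ≤ s ∧ 0 ≤ t ∧
      x = r * a₀ + s * b₀ + t * c₀ ∧ y = r * a₁ + s * b₁ + t * c₁) :
    ∃ p q : ℚ, 0 < p ∧ 0 ≤ q ∧
      p * ((a₀ * b₁ - b₀ * a₁ : ℤ) : ℚ) = q * ((b₀ * c₁ - c₀ * b₁ : ℤ) : ℚ) := by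
  obtain ⟨r, s, t, hr, -, ht, hx, hy⟩ := h (-a₀) (-a₁)
  refine ⟨1 + r, t, by linarith, ht, ?_⟩
  push_cast
  linear_combination (-b₁ : ℚ) * hx + (b₀ : ℚ) * hy

/-- A positivity statement is transported along `p * x = q * y` with `p > 0` and `q ≥ 0`. -/
lemma pos_of_pos_mul_eq_nonneg_mul {p q : ℚ} {x y : ℤ} (hp : 0 < p) (hq : 0 ≤ q)
    (h : p * (x : ℚ) = q * (y : ℚ)) (hx : 0 < x) : 0 < y := by
  have hx' : (0 : ℚ) < x := by exact_mod_cast hx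
  have hy : (0 : ℚ) < y := pos_of_mul_pos_right (h ▸ mul_pos hp hx') hq
  exact_mod_cast hy

/-- If three integer vectors generate `ℚ²` as a convex cone, then their cyclic determinants are
nonzero and have the same sign. -/
lemma exists_sign_mul_det_pos {a₀ a₁ b₀ b₁ c₀ c₁ : ℤ} (ha : IsCoprime a₀ a₁)
    (h : ∀ x y : ℚ, ∃ r s t : ℚ, 0 ≤ r ∧ 0 ≤ s ∧ 0 ≤ t ∧
      x = r * a₀ + s * b₀ + t * c₀ ∧ y = r * a₁ + s * b₁ + t * c₁) :
    ∃ e : ℤ, (e = 1 ∨ e = -1) ∧ 0 < e * (b₀ * c₁ - c₀ * b₁) ∧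
      0 < e * (c₀ * a₁ - a₀ * c₁) ∧ 0 < e * (a₀ * b₁ - b₀ * a₁) := by
  obtain ⟨p, q, hp, hq, e₁⟩ := exists_pos_mul_det_eq_nonneg_mul_det h
  obtain ⟨p', q', hp', hq', e₂⟩ := exists_pos_mul_det_eq_nonneg_mul_det
    (a₀ := b₀) (a₁ := b₁) (b₀ := c₀) (b₁ := c₁) (c₀ := a₀) (c₁ := a₁) fun x y ↦ by
      obtain ⟨r, s, t, hr, hs, ht, hx, hy⟩ := h x y
      exact ⟨s, t, r, hs, ht, hr, by linarith, by linarith⟩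
  obtain ⟨p'', q'', hp'', hq'', e₃⟩ := exists_pos_mul_det_eq_nonneg_mul_det
    (a₀ := c₀) (a₁ := c₁) (b₀ := a₀) (b₁ := a₁) (c₀ := b₀) (c₁ := b₁) fun x y ↦ by
      obtain ⟨r, s, t, hr, hs, ht, hx, hy⟩ := h x y
      exact ⟨t, r, s, ht, hr, hs, by linarith, by linarith⟩
  have hne : b₀ * c₁ - c₀ * b₁ ≠ 0 := by
    intro h₀
    have hab : (a₀ : ℚ) * b₁ - b₀ * a₁ = 0 := by
      rw [h₀] at e₁
      have := (mul_eq_zero.mp (e₁.trans (by simp))).resolve_left hp.ne'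
      exact_mod_cast this
    have hca : (c₀ : ℚ) * a₁ - a₀ * c₁ = 0 := by
      have hab' : a₀ * b₁ - b₀ * a₁ = 0 := by exact_mod_cast hab
      rw [hab'] at e₃
      have := (mul_eq_zero.mp (e₃.trans (by simp))).resolve_left hp''.ne'
      exact_mod_cast this
    obtain ⟨u, v, huv⟩ := ha
    have huv' : (u : ℚ) * a₀ + v * a₁ = 1 := by exact_mod_cast huv
    obtain ⟨r, s, t, -, -, -, hx, hy⟩ := h (-v) u
    have : (1 : ℚ) = 0 := by
      linear_combination -huv' + (a₀ : ℚ) * hy - (a₁ : ℚ) * hx + s * hab - t * hca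
    exact one_ne_zero this
  rcases hne.lt_or_gt with hlt | hgt
  · have neg_cast {p q : ℚ} {x y : ℤ} (h : p * (x : ℚ) = q * (y : ℚ)) :
        p * ((-x : ℤ) : ℚ) = q * ((-y : ℤ) : ℚ) := by
      push_cast
      linear_combination -h
    have h₀ := neg_pos.mpr hlt
    have h₁ := pos_of_pos_mul_eq_nonneg_mul hp' hq' (neg_cast e₂) h₀
    have h₂ := pos_of_pos_mul_eq_nonneg_mul hp'' hq'' (neg_cast e₃) h₁
    exact ⟨-1, .inr rfl, by linarith, by linarith, by linarith⟩
  · have h₁ := pos_of_pos_mul_eq_nonneg_mul hp' hq' e₂ hgt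
    have h₂ := pos_of_pos_mul_eq_nonneg_mul hp'' hq'' e₃ h₁
    exact ⟨1, .inl rfl, by linarith, by linarith, by linarith⟩

/-- If `x * a + y * b + z * c = 0` for integer vectors `a`, `b`, `c` with `c` primitive, and
`x`, `y`, `z` have no common factor, then `x` and `y` are coprime. -/
lemma gcd_eq_one_of_relation {x y z a₀ a₁ b₀ b₁ c₀ c₁ : ℤ} (hc : IsCoprime c₀ c₁)
    (h₀ : x * a₀ + y * b₀ + z * c₀ = 0) (h₁ : x * a₁ + y * b₁ + z * c₁ = 0)
    (hgcd : ∀ d : ℤ, d ∣ x → d ∣ y → d ∣ z → d ∣ 1) : Int.gcd x y = 1 := by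
  have hx := Int.gcd_dvd_left x y
  have hy := Int.gcd_dvd_right x y
  obtain ⟨u, v, huv⟩ := hc
  have hz : (Int.gcd x y : ℤ) ∣ z := by
    have hz' : z = x * -(u * a₀ + v * a₁) + y * -(u * b₀ + v * b₁) := by
      linear_combination -z * huv + u * h₀ + v * h₁
    rw [hz']
    exact dvd_add (hx.mul_right _) (hy.mul_right _)
  exact_mod_cast Int.eq_one_of_dvd_one (Int.natCast_nonneg _) (hgcd _ hx hy hz)

/-- let `P = [v₀ v₁ v₂]` be a `2×3` integer matrix whose columns are
primitive and generate `ℚ²` as a convex cone.  With `m₀ := |det[v₁ v₂]|`,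
`m₁ := |det[v₀ v₂]|`, `m₂ := |det[v₀ v₁]|`, `N := gcd(m₀, m₁, m₂)` and `w_i := m_i / N`
(encoded by `m i = N·w i`), the `w_i` are pairwise coprime positive integers and there
exist `0 ≤ x < N·w₂` with `gcd(x, N·w₂) = 1` and `A ∈ GL₂(ℤ)` such that `w₂` divides
`w₀ + x·w₁` and `A·P = [[1, x, −(w₀ + x·w₁)/w₂], [0, N·w₂, −N·w₁]]`. -/
theorem stmt16 (P : Matrix (Fin 2) (Fin 3) ℤ)
    (hprim : ∀ j, IsCoprime (P 0 j) (P 1 j))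
    (hcone : ∀ x : Fin 2 → ℚ, ∃ c : Fin 3 → ℚ,
      (∀ j, 0 ≤ c j) ∧ ∀ k, x k = ∑ j, c j * ((P k j : ℤ) : ℚ))
    (m : Fin 3 → ℤ)
    (hm0 : m 0 = |P 0 1 * P 1 2 - P 0 2 * P 1 1|)
    (hm1 : m 1 = |P 0 0 * P 1 2 - P 0 2 * P 1 0|)
    (hm2 : m 2 = |P 0 0 * P 1 1 - P 0 1 * P 1 0|)
    (N : ℕ) (hN : N = Int.gcd (m 0) (Int.gcd (m 1) (m 2)))
    (w : Fin 3 → ℤ) (hw : ∀ i, m i = (N : ℤ) * w i) :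
    (∀ i, 0 < w i) ∧
    (∀ i j, i ≠ j → Int.gcd (w i) (w j) = 1) ∧
    ∃ x : ℤ, 0 ≤ x ∧ x < (N : ℤ) * w 2 ∧ Int.gcd x ((N : ℤ) * w 2) = 1 ∧
      w 2 ∣ (w 0 + x * w 1) ∧
      ∃ A : Matrix (Fin 2) (Fin 2) ℤ, (A.det = 1 ∨ A.det = -1) ∧
        A * P = Matrix.of !![1, x, -((w 0 + x * w 1) / w 2);
                            0, (N : ℤ) * w 2, -((N : ℤ) * w 1)] := by
  obtain ⟨e, he, h₀, h₁, h₂⟩ := exists_sign_mul_det_pos (hprim 0) fun x y ↦ by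
    obtain ⟨c, hc, hx⟩ := hcone ![x, y]
    have hx₀ := hx 0
    have hx₁ := hx 1
    simp only [Fin.sum_univ_three, Matrix.cons_val_zero, Matrix.cons_val_one] at hx₀ hx₁
    exact ⟨c 0, c 1, c 2, hc 0, hc 1, hc 2, hx₀, hx₁⟩
  have abs_eq {z : ℤ} (hz : 0 < e * z) : |z| = e * z := by
    rcases he with rfl | rfl
    · rw [abs_of_pos (by linarith), one_mul]
    · rw [abs_of_neg (by linarith), neg_one_mul]
  have he2 : e * e = 1 := by rcases he with rfl | rfl <;> rfl
  have m0 : (N : ℤ) * w 0 = e * (P 0 1 * P 1 2 - P 0 2 * P 1 1) := by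
    rw [← hw, hm0, abs_eq h₀]
  have m1 : (N : ℤ) * w 1 = e * (P 0 2 * P 1 0 - P 0 0 * P 1 2) := by
    rw [← hw, hm1, abs_sub_comm, abs_eq h₁]
  have m2 : (N : ℤ) * w 2 = e * (P 0 0 * P 1 1 - P 0 1 * P 1 0) := by
    rw [← hw, hm2, abs_eq h₂]
  rw [← m0] at h₀
  rw [← m1] at h₁
  rw [← m2] at h₂
  have hNpos : 0 < (N : ℤ) :=
    (Int.natCast_nonneg N).lt_of_ne fun h ↦ by simp [← h] at h₀
  have hwpos : ∀ i, 0 < w i := by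
    intro i
    fin_cases i
    exacts [pos_of_mul_pos_right h₀ hNpos.le, pos_of_mul_pos_right h₁ hNpos.le,
      pos_of_mul_pos_right h₂ hNpos.le]
  have rel : ∀ k, w 0 * P k 0 + w 1 * P k 1 + w 2 * P k 2 = 0 := by
    intro k
    apply mul_left_cancel₀ hNpos.ne'
    fin_cases k
    · change (N : ℤ) * (w 0 * P 0 0 + w 1 * P 0 1 + w 2 * P 0 2) = N * 0
      linear_combination P 0 0 * m0 + P 0 1 * m1 + P 0 2 * m2
    · change (N : ℤ) * (w 0 * P 1 0 + w 1 * P 1 1 + w 2 * P 1 2) = N * 0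
      linear_combination P 1 0 * m0 + P 1 1 * m1 + P 1 2 * m2
  have hgcd : ∀ d : ℤ, d ∣ w 0 → d ∣ w 1 → d ∣ w 2 → d ∣ 1 := by
    intro d hd0 hd1 hd2
    have hd : (N : ℤ) * d ∣ N := by
      conv_rhs => rw [hN]
      refine Int.dvd_coe_gcd ?_ (Int.dvd_coe_gcd ?_ ?_) <;> rw [hw]
      exacts [mul_dvd_mul_left _ hd0, mul_dvd_mul_left _ hd1, mul_dvd_mul_left _ hd2]
    exact (mul_dvd_mul_iff_left hNpos.ne').mp (by simpa using hd)
  have g01 : Int.gcd (w 0) (w 1) = 1 :=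
    gcd_eq_one_of_relation (hprim 2) (rel 0) (rel 1) hgcd
  have g02 : Int.gcd (w 0) (w 2) = 1 :=
    gcd_eq_one_of_relation (hprim 1) (a₀ := P 0 0) (a₁ := P 1 0) (b₀ := P 0 2) (b₁ := P 1 2)
      (by linarith [rel 0]) (by linarith [rel 1]) fun d hd0 hd2 hd1 ↦ hgcd d hd0 hd1 hd2
  have g12 : Int.gcd (w 1) (w 2) = 1 :=
    gcd_eq_one_of_relation (hprim 0) (a₀ := P 0 1) (a₁ := P 1 1) (b₀ := P 0 2) (b₁ := P 1 2)
      (by linarith [rel 0]) (by linarith [rel 1]) fun d hd1 hd2 hd0 ↦ hgcd d hd0 hd1 hd2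
  refine ⟨hwpos, ?_, ?_⟩
  · intro i j hij
    fin_cases i <;> fin_cases j <;> first | exact absurd rfl hij | skip
    exacts [g01, g02, Int.gcd_comm _ _ ▸ g01, g12, Int.gcd_comm _ _ ▸ g02,
      Int.gcd_comm _ _ ▸ g12]
  obtain ⟨a, b, hab⟩ := hprim 0
  obtain ⟨u, v, huv⟩ := hprim 1
  set x₀ := a * P 0 1 + b * P 1 1 with hx₀
  set k := x₀ / (N * w 2) with hk
  set x := x₀ % (N * w 2) with hx
  have hxk : x = x₀ - N * w 2 * k := by
    rw [hx, hk, Int.emod_def]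
  set y := a * P 0 2 + b * P 1 2 + N * w 1 * k with hy
  have hrel : w 0 + x * w 1 = w 2 * -y := by
    rw [hxk, hy, hx₀]
    linear_combination a * rel 0 + b * rel 1 - w 0 * hab
  refine ⟨x, Int.emod_nonneg _ h₂.ne', Int.emod_lt_of_pos _ h₂, ?_, ⟨_, hrel⟩,
    !![a + k * e * P 1 0, b - k * e * P 0 0; -e * P 1 0, e * P 0 0], ?_, ?_⟩
  · rw [← Int.isCoprime_iff_gcd_eq_one]
    refine ⟨u * P 0 0 + v * P 1 0, (u * P 0 0 + v * P 1 0) * k + e * (v * a - u * b), ?_⟩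
    rw [hxk, hx₀]
    linear_combination e * (v * a - u * b) * m2 + huv + (u * P 0 1 + v * P 1 1) * hab +
      (v * a - u * b) * (P 0 0 * P 1 1 - P 0 1 * P 1 0) * he2
  · have hdet : (a + k * e * P 1 0) * (e * P 0 0) - (b - k * e * P 0 0) * (-e * P 1 0) = e := by
      linear_combination e * hab
    rw [Matrix.det_fin_two_of, hdet]
    exact he
  · rw [hrel, Int.mul_ediv_cancel_left _ (hwpos 2).ne', neg_neg]
    change _ = !![1, x, y; 0, (N : ℤ) * w 2, -((N : ℤ) * w 1)]
    ext i j
    fin_cases i <;> fin_cases j <;> simp [Matrix.mul_apply, Fin.sum_univ_two]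
    · linear_combination hab
    · linear_combination -hxk - hx₀ + k * m2
    · linear_combination -hy - k * m1
    · ring
    · linear_combination -m2
    · linear_combination m1
end
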